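/- Let C be a locally presentable category with a cofibrantly generated weak factorization system (L, R) such that ∅ → X lies in L for every object X, equipped with an exact cylinder I and a class An^l(I) of left I-anodyne extensions. Then there exists a unique model category structure on C in which: (1) the class of cofibrations is exactly L; (2) a morphism f : A → B is a weak equivalence if and only if for every left I-fibrant object W the induced map f* : [B, W]_I → [A, W]_I is bijective. Moreover, in this model structure an object is fibrant if and only if it is left I-fibrant, and a morphism between left I-fibrant objects is a fibration if and only if it is a left I-fibration. -/

import Mathlib

set_option linter.unusedSectionVars false

open CategoryTheory CategoryTheory.Limits

universe v u

namespace Paper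

variable {C : Type u} [Category.{v} C]

/-- The class of morphisms having the left lifting property against every morphism in `T`. -/
def llp (T : MorphismProperty C) : MorphismProperty C :=
  fun _ _ f => ∀ ⦃X Y : C⦄ (g : X ⟶ Y), T g → HasLiftingProperty f g

/-- The class of morphisms having the right lifting property against every morphism in `T`. -/
def rlp (T : MorphismProperty C) : MorphismProperty C :=
  fun _ _ g => ∀ ⦃A B : C⦄ (f : A ⟶ B), T f → HasLiftingProperty f g

/-- The morphism property associated to a set of arrows. -/
def ofArrows (S : Set (Arrow C)) : MorphismProperty C :=
  fun _ _ f => Arrow.mk f ∈ S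

/-- A (possibly large) category `J` is `κ`-filtered if every diagram in `J` indexed by a
small category of size `< κ` admits a cocone. -/
def IsCardinalFiltered (J : Cat.{v, v}) (κ : Cardinal.{v}) : Prop :=
  ∀ K : Cat.{v, v}, Cardinal.mk (Arrow K) < κ → ∀ F : K ⥤ J, Nonempty (Cocone F)

/-- An object `X` is `κ`-presentable if `Hom(X, -)` preserves colimits of `κ`-filtered
diagrams. -/
def IsPresentableObj (κ : Cardinal.{v}) (X : C) : Prop :=
  ∀ J : Cat.{v, v}, IsCardinalFiltered J κ →
    PreservesColimitsOfShape J (coyoneda.obj (Opposite.op X))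

/-- A category is locally presentable if it is cocomplete and there is a regular cardinal `κ`
and a small family of `κ`-presentable objects such that every object is a `κ`-filtered colimit
of objects of the family. -/
class LocallyPresentable (C : Type u) [Category.{v} C] extends HasColimits C : Prop where
  exists_presentable_generator :
    ∃ κ : Cardinal.{v}, κ.IsRegular ∧
      ∃ (ι : Type v) (G : ι → C), (∀ i, IsPresentableObj κ (G i)) ∧
        ∀ X : C, ∃ (J : Cat.{v, v}) (F : J ⥤ C) (c : Cocone F),
          IsCardinalFiltered J κ ∧ Nonempty (IsColimit c) ∧
          (∀ j : J, ∃ i, Nonempty (F.obj j ≅ G i)) ∧ Nonempty (c.pt ≅ X)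

/-- `(L, R)` is a cofibrantly generated weak factorization system such that every morphism
from the initial object is in `L`. -/
structure IsCofGenWFS [HasColimits C] (L R : MorphismProperty C) : Prop where
  exists_generating_set : ∃ S : Set (Arrow C), Small.{v} S ∧ L = llp (rlp (ofArrows S))
  rlp_eq : R = rlp L
  factorization : ∀ ⦃X Y : C⦄ (f : X ⟶ Y),
    ∃ (Z : C) (i : X ⟶ Z) (p : Z ⟶ Y), L i ∧ R p ∧ i ≫ p = f
  initial_mem : ∀ X : C, L (initial.to X)

/-- A functorial cylinder on `C`. -/
structure Cylinder (C : Type u) [Category.{v} C] where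
  I : C ⥤ C
  d0 : 𝟭 C ⟶ I
  d1 : 𝟭 C ⟶ I
  σ : I ⟶ 𝟭 C
  d0_σ : ∀ X : C, d0.app X ≫ σ.app X = 𝟙 X
  d1_σ : ∀ X : C, d1.app X ≫ σ.app X = 𝟙 X

namespace Cylinder

variable (E : Cylinder C)

lemma d0_naturality' {K M : C} (f : K ⟶ M) :
    f ≫ E.d0.app M = E.d0.app K ≫ E.I.map f := by
  simpa using E.d0.naturality f

lemma d1_naturality' {K M : C} (f : K ⟶ M) :
    f ≫ E.d1.app M = E.d1.app K ≫ E.I.map f := by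
  simpa using E.d1.naturality f

variable [HasColimits C]

/-- The canonical map `X ⊔ X ⟶ I(X)`. -/
noncomputable def ι (X : C) : X ⨿ X ⟶ E.I.obj X :=
  coprod.desc (E.d0.app X) (E.d1.app X)

lemma ι_naturality {K M : C} (f : K ⟶ M) :
    coprod.map f f ≫ E.ι M = E.ι K ≫ E.I.map f := by
  have h0 := E.d0.naturality f
  have h1 := E.d1.naturality f
  simp only [Functor.id_map] at h0 h1
  apply coprod.hom_ext <;> simp [ι, h0, h1]

/-- The pushout-corner map `∂I ⊠ f : (M ⊔ M) ⊔_{K ⊔ K} I(K) ⟶ I(M)`. -/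
noncomputable def boundaryBox {K M : C} (f : K ⟶ M) :
    pushout (coprod.map f f) (E.ι K) ⟶ E.I.obj M :=
  pushout.desc (E.ι M) (E.I.map f) (E.ι_naturality f)

/-- The pushout-corner map `∂0 ⊠ f : M ⊔_K I(K) ⟶ I(M)`. -/
noncomputable def box0 {K M : C} (f : K ⟶ M) :
    pushout f (E.d0.app K) ⟶ E.I.obj M :=
  pushout.desc (E.d0.app M) (E.I.map f) (E.d0_naturality' f)

/-- The pushout-corner map `∂1 ⊠ f : M ⊔_K I(K) ⟶ I(M)`. -/
noncomputable def box1 {K M : C} (f : K ⟶ M) :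
    pushout f (E.d1.app K) ⟶ E.I.obj M :=
  pushout.desc (E.d1.app M) (E.I.map f) (E.d1_naturality' f)

end Cylinder

/-- A cylinder is exact with respect to the class `L` if it preserves small colimits,
the maps `X ⊔ X ⟶ I(X)` are in `L`, and the pushout-corner maps of morphisms of `L` are
again in `L`. -/
structure IsExactCylinder [HasColimits C] (E : Cylinder C) (L : MorphismProperty C) : Prop where
  preservesColimits : PreservesColimits E.I
  ι_mem : ∀ X : C, L (E.ι X)
  boundaryBox_mem : ∀ ⦃K M : C⦄ (f : K ⟶ M), L f → L (E.boundaryBox f)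
  box0_mem : ∀ ⦃K M : C⦄ (f : K ⟶ M), L f → L (E.box0 f)
  box1_mem : ∀ ⦃K M : C⦄ (f : K ⟶ M), L f → L (E.box1 f)

/-- `An` is a class of right `I`-anodyne extensions. -/
structure IsRightAnodyneClass [HasColimits C] (E : Cylinder C) (L : MorphismProperty C)
    (An : MorphismProperty C) : Prop where
  le : An ≤ L
  exists_generating_set : ∃ Λ : Set (Arrow C), Small.{v} Λ ∧ ofArrows Λ ≤ L ∧
    An = llp (rlp (ofArrows Λ))
  box1_mem : ∀ ⦃K M : C⦄ (f : K ⟶ M), L f → An (E.box1 f)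
  boundaryBox_mem : ∀ ⦃K M : C⦄ (f : K ⟶ M), An f → An (E.boundaryBox f)

/-- `An` is a class of left `I`-anodyne extensions. -/
structure IsLeftAnodyneClass [HasColimits C] (E : Cylinder C) (L : MorphismProperty C)
    (An : MorphismProperty C) : Prop where
  le : An ≤ L
  exists_generating_set : ∃ Λ : Set (Arrow C), Small.{v} Λ ∧ ofArrows Λ ≤ L ∧
    An = llp (rlp (ofArrows Λ))
  box0_mem : ∀ ⦃K M : C⦄ (f : K ⟶ M), L f → An (E.box0 f)
  boundaryBox_mem : ∀ ⦃K M : C⦄ (f : K ⟶ M), An f → An (E.boundaryBox f)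

/-- A morphism is an `An`-fibration if it has the right lifting property against all
morphisms of `An`. -/
def IsFib (An : MorphismProperty C) {X Y : C} (p : X ⟶ Y) : Prop :=
  ∀ ⦃A B : C⦄ (f : A ⟶ B), An f → HasLiftingProperty f p

/-- An object `W` is `An`-fibrant if the map `W ⟶ *` has the right lifting property against
all morphisms of `An`, i.e. every morphism to `W` extends along every morphism of `An`. -/
def IsFibrantObj (An : MorphismProperty C) (W : C) : Prop :=
  ∀ ⦃A B : C⦄ (f : A ⟶ B), An f → ∀ a : A ⟶ W, ∃ b : B ⟶ W, f ≫ b = a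

namespace Cylinder

variable (E : Cylinder C)

/-- An `I`-homotopy from `f` to `g`. -/
def Homotopy {X Y : C} (f g : X ⟶ Y) : Prop :=
  ∃ h : E.I.obj X ⟶ Y, E.d0.app X ≫ h = f ∧ E.d1.app X ≫ h = g

/-- `[X, Y]_I`, the quotient of `Hom(X, Y)` by the equivalence relation generated by
`I`-homotopy. -/
def HoHom (X Y : C) : Type v :=
  Quot (fun f g : X ⟶ Y => E.Homotopy f g)

/-- Precomposition `f^* : [B, W]_I ⟶ [A, W]_I`. -/
def precompQ {A B : C} (f : A ⟶ B) (W : C) : E.HoHom B W → E.HoHom A W :=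
  Quot.lift (fun g => Quot.mk _ (f ≫ g)) (by
    rintro g g' ⟨h, h0, h1⟩
    apply Quot.sound
    refine ⟨E.I.map f ≫ h, ?_, ?_⟩
    · rw [← Category.assoc, ← E.d0_naturality' f, Category.assoc, h0]
    · rw [← Category.assoc, ← E.d1_naturality' f, Category.assoc, h1])

end Cylinder

/-- `f` is a weak equivalence if it induces bijections `[B, W]_I ≅ [A, W]_I` for all
fibrant `W`. -/
def IsWeakEq (E : Cylinder C) (An : MorphismProperty C) {A B : C} (f : A ⟶ B) : Prop :=
  ∀ W : C, IsFibrantObj An W → Function.Bijective (E.precompQ f W)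

/-- `f` is a retract of `f'`. -/
def IsRetractOf {X Y X' Y' : C} (f : X ⟶ Y) (f' : X' ⟶ Y') : Prop :=
  ∃ (i : X ⟶ X') (r : X' ⟶ X) (j : Y ⟶ Y') (s : Y' ⟶ Y),
    i ≫ r = 𝟙 X ∧ j ≫ s = 𝟙 Y ∧ i ≫ f' = f ≫ j ∧ f' ≫ s = r ≫ f

/-- A model structure on a category: the classes of weak equivalences, cofibrations and
fibrations, subject to the two-out-of-three, retract, lifting and factorization axioms. -/
structure ModelStructure (C : Type u) [Category.{v} C] where
  weq : MorphismProperty C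
  cof : MorphismProperty C
  fib : MorphismProperty C
  weq_id : ∀ X : C, weq (𝟙 X)
  weq_comp : ∀ ⦃X Y Z : C⦄ (f : X ⟶ Y) (g : Y ⟶ Z), weq f → weq g → weq (f ≫ g)
  weq_cancel_left : ∀ ⦃X Y Z : C⦄ (f : X ⟶ Y) (g : Y ⟶ Z), weq f → weq (f ≫ g) → weq g
  weq_cancel_right : ∀ ⦃X Y Z : C⦄ (f : X ⟶ Y) (g : Y ⟶ Z), weq g → weq (f ≫ g) → weq f
  weq_retract : ∀ ⦃X Y X' Y' : C⦄ (f : X ⟶ Y) (f' : X' ⟶ Y'),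
    IsRetractOf f f' → weq f' → weq f
  cof_retract : ∀ ⦃X Y X' Y' : C⦄ (f : X ⟶ Y) (f' : X' ⟶ Y'),
    IsRetractOf f f' → cof f' → cof f
  fib_retract : ∀ ⦃X Y X' Y' : C⦄ (f : X ⟶ Y) (f' : X' ⟶ Y'),
    IsRetractOf f f' → fib f' → fib f
  lift_trivCof_fib : ∀ ⦃A B X Y : C⦄ (i : A ⟶ B) (p : X ⟶ Y),
    cof i → weq i → fib p → HasLiftingProperty i p
  lift_cof_trivFib : ∀ ⦃A B X Y : C⦄ (i : A ⟶ B) (p : X ⟶ Y),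
    cof i → fib p → weq p → HasLiftingProperty i p
  fact_cof_trivFib : ∀ ⦃X Y : C⦄ (f : X ⟶ Y),
    ∃ (Z : C) (i : X ⟶ Z) (p : Z ⟶ Y), cof i ∧ fib p ∧ weq p ∧ i ≫ p = f
  fact_trivCof_fib : ∀ ⦃X Y : C⦄ (f : X ⟶ Y),
    ∃ (Z : C) (i : X ⟶ Z) (p : Z ⟶ Y), cof i ∧ weq i ∧ fib p ∧ i ≫ p = f

/-- An object `W` is fibrant for a model structure if every morphism to `W` extends along
every trivial cofibration, i.e. `W ⟶ *` has the right lifting property against trivial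
cofibrations. -/
def ModelStructure.Fibrant (M : ModelStructure C) (W : C) : Prop :=
  ∀ ⦃A B : C⦄ (i : A ⟶ B), M.cof i → M.weq i → ∀ a : A ⟶ W, ∃ b : B ⟶ W, i ≫ b = a

universe u' w₁ w₂

section Homotopy

variable [HasColimits C] {L R An : MorphismProperty C} {E : Cylinder C}

lemma Cylinder.inl_ι (X : C) : coprod.inl ≫ E.ι X = E.d0.app X := coprod.inl_desc _ _

lemma Cylinder.inr_ι (X : C) : coprod.inr ≫ E.ι X = E.d1.app X := coprod.inr_desc _ _

lemma Cylinder.inl_box0 {K M : C} (f : K ⟶ M) :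
    pushout.inl f (E.d0.app K) ≫ E.box0 f = E.d0.app M := pushout.inl_desc _ _ _

lemma Cylinder.inr_box0 {K M : C} (f : K ⟶ M) :
    pushout.inr f (E.d0.app K) ≫ E.box0 f = E.I.map f := pushout.inr_desc _ _ _

lemma Cylinder.d0_map_ι (X : C) :
    E.d1.app X ≫ E.I.map coprod.inl ≫ E.I.map (E.ι X) = E.d0.app X ≫ E.d1.app (E.I.obj X) := by
  rw [← E.I.map_comp, Cylinder.inl_ι]
  exact (E.d1_naturality' (E.d0.app X)).symm

lemma Cylinder.d1_map_ι (X : C) :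
    E.d1.app X ≫ E.I.map coprod.inr ≫ E.I.map (E.ι X) = E.d1.app X ≫ E.d1.app (E.I.obj X) := by
  rw [← E.I.map_comp, Cylinder.inr_ι]
  exact (E.d1_naturality' (E.d1.app X)).symm

lemma Cylinder.d0_σ_comp (E : Cylinder C) {X Y : C} (f : X ⟶ Y) :
    E.d0.app X ≫ E.σ.app X ≫ f = f := by
  rw [← Category.assoc, E.d0_σ]
  exact Category.id_comp f

lemma Cylinder.d1_σ_comp (E : Cylinder C) {X Y : C} (f : X ⟶ Y) :
    E.d1.app X ≫ E.σ.app X ≫ f = f := by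
  rw [← Category.assoc, E.d1_σ]
  exact Category.id_comp f

lemma Cylinder.map_d0_σ_comp (E : Cylinder C) {X Y : C} (f : E.I.obj X ⟶ Y) :
    E.I.map (E.d0.app X) ≫ E.I.map (E.σ.app X) ≫ f = f := by
  rw [← Category.assoc, ← E.I.map_comp, E.d0_σ]
  exact (E.I.map_id X =≫ f).trans (Category.id_comp f)

lemma Cylinder.d0_map_comp (E : Cylinder C) {K M Y : C} (u : K ⟶ M) (f : E.I.obj M ⟶ Y) :
    E.d0.app K ≫ E.I.map u ≫ f = u ≫ E.d0.app M ≫ f := by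
  rw [← Category.assoc, ← E.d0_naturality']
  exact Category.assoc _ _ _

lemma Cylinder.map_d1_σ_comp (E : Cylinder C) {X Y : C} (f : E.I.obj X ⟶ Y) :
    E.I.map (E.d1.app X) ≫ E.I.map (E.σ.app X) ≫ f = f := by
  rw [← Category.assoc, ← E.I.map_comp, E.d1_σ]
  exact (E.I.map_id X =≫ f).trans (Category.id_comp f)

lemma Cylinder.d1_map_comp (E : Cylinder C) {K M Y : C} (u : K ⟶ M) (f : E.I.obj M ⟶ Y) :
    E.d1.app K ≫ E.I.map u ≫ f = u ≫ E.d1.app M ≫ f := by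
  rw [← Category.assoc, ← E.d1_naturality']
  exact Category.assoc _ _ _

lemma Cylinder.map_σ_comp (E : Cylinder C) {K M Y : C} (u : K ⟶ M) (f : M ⟶ Y) :
    E.I.map u ≫ E.σ.app M ≫ f = E.σ.app K ≫ u ≫ f := by
  rw [← Category.assoc, E.σ.naturality]
  exact Category.assoc _ _ _

lemma IsLeftAnodyneClass.exists_extension (hA : IsLeftAnodyneClass E L An) {K M W : C}
    {i : K ⟶ M} (hi : L i) (hW : IsFibrantObj An W) (b : M ⟶ W) (h : E.I.obj K ⟶ W)
    (w : i ≫ b = E.d0.app K ≫ h) :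
    ∃ H : E.I.obj M ⟶ W, E.d0.app M ≫ H = b ∧ E.I.map i ≫ H = h := by
  obtain ⟨H, hH⟩ := hW _ (hA.box0_mem i hi) (pushout.desc b h w)
  refine ⟨H, ?_, ?_⟩
  · rw [← Cylinder.inl_box0 i, Category.assoc, hH, pushout.inl_desc]
  · rw [← Cylinder.inr_box0 i, Category.assoc, hH, pushout.inr_desc]

lemma IsLeftAnodyneClass.exists_lift (hA : IsLeftAnodyneClass E L An) {K M X Y : C}
    {i : K ⟶ M} (hi : L i) {p : X ⟶ Y} (hp : IsFib An p) (b : M ⟶ X) (h : E.I.obj K ⟶ X)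
    (w : i ≫ b = E.d0.app K ≫ h) (t : E.I.obj M ⟶ Y) (hb : E.d0.app M ≫ t = b ≫ p)
    (hh : E.I.map i ≫ t = h ≫ p) :
    ∃ H : E.I.obj M ⟶ X, E.d0.app M ≫ H = b ∧ E.I.map i ≫ H = h ∧ H ≫ p = t := by
  have := hp _ (hA.box0_mem i hi)
  have sq : CommSq (pushout.desc b h w) (E.box0 i) p t := ⟨by
    apply pushout.hom_ext
    · rw [pushout.inl_desc_assoc, ← Category.assoc, Cylinder.inl_box0, hb]
    · rw [pushout.inr_desc_assoc, ← Category.assoc, Cylinder.inr_box0, hh]⟩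
  refine ⟨sq.lift, ?_, ?_, sq.fac_right⟩
  · rw [← Cylinder.inl_box0 i, Category.assoc, sq.fac_left, pushout.inl_desc]
  · rw [← Cylinder.inr_box0 i, Category.assoc, sq.fac_left, pushout.inr_desc]

lemma IsLeftAnodyneClass.exists_homotopy_extension (hA : IsLeftAnodyneClass E L An) {K M W : C}
    {i : K ⟶ M} (hi : An i) (hW : IsFibrantObj An W) (b₀ b₁ : M ⟶ W) (h : E.I.obj K ⟶ W)
    (h₀ : E.d0.app K ≫ h = i ≫ b₀) (h₁ : E.d1.app K ≫ h = i ≫ b₁) :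
    ∃ H : E.I.obj M ⟶ W, E.d0.app M ≫ H = b₀ ∧ E.d1.app M ≫ H = b₁ := by
  have w : coprod.map i i ≫ coprod.desc b₀ b₁ = E.ι K ≫ h := by
    apply coprod.hom_ext
    · rw [← Category.assoc coprod.inl (E.ι K), Cylinder.inl_ι, h₀, coprod.inl_map_assoc,
        coprod.inl_desc]
    · rw [← Category.assoc coprod.inr (E.ι K), Cylinder.inr_ι, h₁, coprod.inr_map_assoc,
        coprod.inr_desc]
  obtain ⟨H, hH⟩ := hW _ (hA.boundaryBox_mem i hi) (pushout.desc _ h w)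
  have hH' : E.ι M ≫ H = coprod.desc b₀ b₁ := by
    have := pushout.inl (coprod.map i i) (E.ι K) ≫= hH
    rw [pushout.inl_desc] at this
    rw [← this, Cylinder.boundaryBox, pushout.inl_desc_assoc]
  refine ⟨H, ?_, ?_⟩
  · rw [← Cylinder.inl_ι, Category.assoc, hH', coprod.inl_desc]
  · rw [← Cylinder.inr_ι, Category.assoc, hH', coprod.inr_desc]

lemma IsExactCylinder.coprod_hom_ext (hE : IsExactCylinder E L) {X W : C}
    {f g : E.I.obj (X ⨿ X) ⟶ W}
    (h₀ : E.I.map coprod.inl ≫ f = E.I.map coprod.inl ≫ g)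
    (h₁ : E.I.map coprod.inr ≫ f = E.I.map coprod.inr ≫ g) : f = g := by
  have := hE.preservesColimits
  let hc := mapIsColimitOfPreservesOfIsColimit E.I _ _ (coprodIsCoprod X X)
  exact BinaryCofan.IsColimit.hom_ext hc h₀ h₁

lemma IsExactCylinder.exists_coprod_desc (hE : IsExactCylinder E L) {X W : C}
    (f g : E.I.obj X ⟶ W) : ∃ m : E.I.obj (X ⨿ X) ⟶ W,
      E.I.map coprod.inl ≫ m = f ∧ E.I.map coprod.inr ≫ m = g := by
  have := hE.preservesColimits
  let hc := mapIsColimitOfPreservesOfIsColimit E.I _ _ (coprodIsCoprod X X)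
  obtain ⟨m, h⟩ := BinaryCofan.IsColimit.desc' hc f g
  exact ⟨m, h⟩

lemma IsLeftAnodyneClass.homotopy_of_square (hA : IsLeftAnodyneClass E L An)
    (hE : IsExactCylinder E L) {X W : C} (hW : IsFibrantObj An W) (c h h' : E.I.obj X ⟶ W)
    (w : E.d0.app X ≫ h = E.d0.app X ≫ c) (w' : E.d0.app X ≫ h' = E.d1.app X ≫ c) :
    E.Homotopy (E.d1.app X ≫ h) (E.d1.app X ≫ h') := by
  obtain ⟨m, hm, hm'⟩ := hE.exists_coprod_desc h h'
  obtain ⟨H, -, hH⟩ := hA.exists_extension (hE.ι_mem X) hW c m (by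
    apply coprod.hom_ext
    · rw [← Category.assoc, Cylinder.inl_ι, ← Category.assoc coprod.inl, E.d0_naturality',
        Category.assoc, hm, w]
    · rw [← Category.assoc, Cylinder.inr_ι, ← Category.assoc coprod.inr, E.d0_naturality',
        Category.assoc, hm', w'])
  refine ⟨E.d1.app _ ≫ H, ?_, ?_⟩
  · rw [← hm, ← hH]
    have := (Cylinder.d0_map_ι X).symm =≫ H
    simp only [Category.assoc] at this
    exact this
  · rw [← hm', ← hH]
    have := (Cylinder.d1_map_ι X).symm =≫ H
    simp only [Category.assoc] at this
    exact this

lemma IsLeftAnodyneClass.exists_homotopy_over (hA : IsLeftAnodyneClass E L An)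
    (hE : IsExactCylinder E L) {X Y Z : C} {p : Y ⟶ Z} (hp : IsFib An p)
    (c h h' : E.I.obj X ⟶ Y)
    (w : E.d0.app X ≫ h = E.d0.app X ≫ c) (w' : E.d0.app X ≫ h' = E.d1.app X ≫ c)
    (t : E.I.obj (E.I.obj X) ⟶ Z) (ht : E.d0.app _ ≫ t = c ≫ p)
    (hh : E.I.map (E.d0.app X) ≫ t = h ≫ p) (hh' : E.I.map (E.d1.app X) ≫ t = h' ≫ p) :
    ∃ k : E.I.obj X ⟶ Y, E.d0.app X ≫ k = E.d1.app X ≫ h ∧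
      E.d1.app X ≫ k = E.d1.app X ≫ h' ∧ k ≫ p = E.d1.app _ ≫ t := by
  obtain ⟨m, hm, hm'⟩ := hE.exists_coprod_desc h h'
  obtain ⟨H, -, hH, hHp⟩ := hA.exists_lift (hE.ι_mem X) hp c m (by
    apply coprod.hom_ext
    · rw [← Category.assoc, Cylinder.inl_ι, ← Category.assoc coprod.inl, E.d0_naturality',
        Category.assoc, hm, w]
    · rw [← Category.assoc, Cylinder.inr_ι, ← Category.assoc coprod.inr, E.d0_naturality',
        Category.assoc, hm', w']) t ht (by
    apply hE.coprod_hom_ext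
    · rw [← Category.assoc, ← E.I.map_comp, Cylinder.inl_ι, hh, ← Category.assoc, hm]
    · rw [← Category.assoc, ← E.I.map_comp, Cylinder.inr_ι, hh', ← Category.assoc, hm'])
  refine ⟨E.d1.app _ ≫ H, ?_, ?_, by rw [Category.assoc, hHp]⟩
  · rw [← hm, ← hH]
    have := (Cylinder.d0_map_ι X).symm =≫ H
    simp only [Category.assoc] at this
    exact this
  · rw [← hm', ← hH]
    have := (Cylinder.d1_map_ι X).symm =≫ H
    simp only [Category.assoc] at this
    exact this

lemma Cylinder.Homotopy.refl (E : Cylinder C) {X Y : C} (f : X ⟶ Y) : E.Homotopy f f :=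
  ⟨E.σ.app X ≫ f, by simp [← Category.assoc, E.d0_σ], by simp [← Category.assoc, E.d1_σ]⟩

lemma Cylinder.Homotopy.precomp {X Y Z : C} {f g : Y ⟶ Z} (h : E.Homotopy f g) (a : X ⟶ Y) :
    E.Homotopy (a ≫ f) (a ≫ g) := by
  obtain ⟨h, h₀, h₁⟩ := h
  refine ⟨E.I.map a ≫ h, ?_, ?_⟩
  · rw [← Category.assoc, ← E.d0_naturality', Category.assoc, h₀]
  · rw [← Category.assoc, ← E.d1_naturality', Category.assoc, h₁]

lemma Cylinder.Homotopy.postcomp {X Y Z : C} {f g : X ⟶ Y} (h : E.Homotopy f g) (a : Y ⟶ Z) :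
    E.Homotopy (f ≫ a) (g ≫ a) := by
  obtain ⟨h, h₀, h₁⟩ := h
  exact ⟨h ≫ a, by rw [← Category.assoc, h₀], by rw [← Category.assoc, h₁]⟩

lemma IsLeftAnodyneClass.equivalence_homotopy (hA : IsLeftAnodyneClass E L An)
    (hE : IsExactCylinder E L) (X : C) {W : C} (hW : IsFibrantObj An W) :
    Equivalence (fun f g : X ⟶ W => E.Homotopy f g) := by
  have key : ∀ {f g k : X ⟶ W}, E.Homotopy f g → E.Homotopy f k → E.Homotopy g k := by
    rintro f _ _ ⟨h, h₀, rfl⟩ ⟨h', h₀', rfl⟩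
    refine hA.homotopy_of_square hE hW (E.σ.app X ≫ f) h h' ?_ ?_
    · rw [h₀, E.d0_σ_comp]
    · rw [h₀', E.d1_σ_comp]
  have symm : ∀ {f g : X ⟶ W}, E.Homotopy f g → E.Homotopy g f :=
    fun h => key h (.refl E _)
  exact ⟨.refl E, symm, fun h h' => key (symm h) h'⟩

lemma IsLeftAnodyneClass.isWeakEq_iff (hA : IsLeftAnodyneClass E L An)
    (hE : IsExactCylinder E L) {A B : C} (f : A ⟶ B) :
    IsWeakEq E An f ↔ ∀ W : C, IsFibrantObj An W →
      (∀ a : A ⟶ W, ∃ b : B ⟶ W, E.Homotopy (f ≫ b) a) ∧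
      (∀ b b' : B ⟶ W, E.Homotopy (f ≫ b) (f ≫ b') → E.Homotopy b b') := by
  refine forall_congr' fun W => forall_congr' fun hW => ?_
  have eA := hA.equivalence_homotopy hE A hW
  have eB := hA.equivalence_homotopy hE B hW
  constructor
  · rintro ⟨h₁, h₂⟩
    refine ⟨fun a => ?_, fun b b' h => ?_⟩
    · obtain ⟨⟨b⟩, hb⟩ := h₂ (Quot.mk _ a)
      exact ⟨b, (eA.quot_mk_eq_iff _ _).1 hb⟩
    · exact (eB.quot_mk_eq_iff _ _).1 (h₁ ((eA.quot_mk_eq_iff _ _).2 h))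
  · rintro ⟨h₁, h₂⟩
    refine ⟨?_, ?_⟩
    · rintro ⟨b⟩ ⟨b'⟩ h
      exact (eB.quot_mk_eq_iff _ _).2 (h₂ b b' ((eA.quot_mk_eq_iff _ _).1 h))
    · rintro ⟨a⟩
      obtain ⟨b, hb⟩ := h₁ a
      exact ⟨Quot.mk _ b, Quot.sound hb⟩

lemma Cylinder.precompQ_comp (E : Cylinder C) {X Y Z : C} (f : X ⟶ Y) (g : Y ⟶ Z) (W : C) :
    E.precompQ (f ≫ g) W = E.precompQ f W ∘ E.precompQ g W := by
  ext ⟨a⟩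
  exact congrArg (Quot.mk _) (Category.assoc f g a)

lemma Cylinder.precompQ_id (E : Cylinder C) (X W : C) : E.precompQ (𝟙 X) W = id := by
  ext ⟨a⟩
  exact congrArg (Quot.mk _) (Category.id_comp a)

lemma IsWeakEq.id (X : C) : IsWeakEq E An (𝟙 X) := fun W _ => by
  rw [E.precompQ_id]; exact Function.bijective_id

lemma IsWeakEq.comp {X Y Z : C} {f : X ⟶ Y} {g : Y ⟶ Z} (hf : IsWeakEq E An f)
    (hg : IsWeakEq E An g) : IsWeakEq E An (f ≫ g) := fun W hW => by
  rw [E.precompQ_comp]; exact (hf W hW).comp (hg W hW)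

lemma IsWeakEq.cancel_left {X Y Z : C} {f : X ⟶ Y} {g : Y ⟶ Z} (hf : IsWeakEq E An f)
    (hfg : IsWeakEq E An (f ≫ g)) : IsWeakEq E An g := fun W hW => by
  have := hfg W hW
  rw [E.precompQ_comp] at this
  exact (Function.Bijective.of_comp_iff' (hf W hW) _).1 this

lemma IsWeakEq.cancel_right {X Y Z : C} {f : X ⟶ Y} {g : Y ⟶ Z} (hg : IsWeakEq E An g)
    (hfg : IsWeakEq E An (f ≫ g)) : IsWeakEq E An f := fun W hW => by
  have := hfg W hW
  rw [E.precompQ_comp] at this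
  exact (Function.Bijective.of_comp_iff _ (hg W hW)).1 this

lemma IsWeakEq.of_comp_of_comp {X Y Z T : C} {f : X ⟶ Y} {g : Y ⟶ Z} {h : Z ⟶ T}
    (hfg : IsWeakEq E An (f ≫ g)) (hgh : IsWeakEq E An (g ≫ h)) : IsWeakEq E An f := by
  have hg : IsWeakEq E An g := fun W hW => by
    have h₁ := hfg W hW
    have h₂ := hgh W hW
    rw [E.precompQ_comp] at h₁ h₂
    exact ⟨h₁.1.of_comp, h₂.2.of_comp⟩
  exact hg.cancel_right hfg

lemma IsWeakEq.retract {X Y X' Y' : C} {f : X ⟶ Y} {f' : X' ⟶ Y'} (h : IsRetractOf f f')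
    (hf : IsWeakEq E An f') : IsWeakEq E An f := by
  obtain ⟨i, r, j, s, hir, hjs, hif, hfs⟩ := h
  intro W hW
  have e₁ := E.precompQ_comp i r W
  have e₂ := E.precompQ_comp j s W
  have e₃ : E.precompQ i W ∘ E.precompQ f' W = E.precompQ f W ∘ E.precompQ j W := by
    rw [← E.precompQ_comp, hif, E.precompQ_comp]
  have e₄ : E.precompQ f' W ∘ E.precompQ s W = E.precompQ r W ∘ E.precompQ f W := by
    rw [← E.precompQ_comp, hfs, E.precompQ_comp]
  rw [hir, E.precompQ_id] at e₁
  rw [hjs, E.precompQ_id] at e₂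
  obtain ⟨h₁, h₂⟩ := hf W hW
  constructor
  · have : Function.Injective (E.precompQ r W ∘ E.precompQ f W) := by
      rw [← e₄]
      exact h₁.comp (Function.LeftInverse.injective (g := E.precompQ j W)
        (fun x => (congrFun e₂ x).symm))
    exact this.of_comp
  · have : Function.Surjective (E.precompQ f W ∘ E.precompQ j W) := by
      rw [← e₃]
      exact (Function.RightInverse.surjective (g := E.precompQ r W)
        (fun x => (congrFun e₁ x).symm)).comp h₂
    exact this.of_comp

lemma IsLeftAnodyneClass.isWeakEq (hA : IsLeftAnodyneClass E L An) (hE : IsExactCylinder E L)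
    {A B : C} {f : A ⟶ B} (hf : An f) : IsWeakEq E An f := by
  rw [hA.isWeakEq_iff hE]
  refine fun W hW => ⟨fun a => ?_, fun b b' ⟨h, h₀, h₁⟩ => ?_⟩
  · obtain ⟨b, rfl⟩ := hW f hf a
    exact ⟨b, .refl E _⟩
  · exact hA.exists_homotopy_extension hf hW b b' h h₀ h₁

lemma isWeakEq_of_right (hW : IsCofGenWFS L R) (hA : IsLeftAnodyneClass E L An)
    (hE : IsExactCylinder E L) {X Y : C} {p : X ⟶ Y} (hp : R p) : IsWeakEq E An p := by
  rw [hW.rlp_eq] at hp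
  obtain ⟨s, hs⟩ : ∃ s : Y ⟶ X, s ≫ p = 𝟙 Y := by
    have := hp _ (hW.initial_mem Y)
    have sq : CommSq (initial.to X) (initial.to Y) p (𝟙 Y) := ⟨by simp⟩
    exact ⟨sq.lift, sq.fac_right⟩
  obtain ⟨h, h₀, h₁⟩ : E.Homotopy (𝟙 X) (p ≫ s) := by
    have := hp _ (hE.ι_mem X)
    have sq : CommSq (coprod.desc (𝟙 X) (p ≫ s)) (E.ι X) p (E.σ.app X ≫ p) := ⟨by
      apply coprod.hom_ext
      · rw [coprod.inl_desc_assoc, ← Category.assoc, Cylinder.inl_ι, ← Category.assoc, E.d0_σ]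
      · rw [coprod.inr_desc_assoc, ← Category.assoc, Cylinder.inr_ι, ← Category.assoc, E.d1_σ,
          Category.assoc, hs, Category.comp_id, Category.id_comp]⟩
    refine ⟨sq.lift, ?_, ?_⟩
    · rw [← Cylinder.inl_ι, Category.assoc, sq.fac_left, coprod.inl_desc]
    · rw [← Cylinder.inr_ι, Category.assoc, sq.fac_left, coprod.inr_desc]
  have hh : E.Homotopy (𝟙 X) (p ≫ s) := ⟨h, h₀, h₁⟩
  rw [hA.isWeakEq_iff hE]
  refine fun W hW => ⟨fun a => ⟨s ≫ a, ?_⟩, fun b b' h => ?_⟩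
  · have := (hA.equivalence_homotopy hE X hW).symm (hh.postcomp a)
    simpa using this
  · have := h.precomp s
    rwa [← Category.assoc, ← Category.assoc, hs, Category.id_comp, Category.id_comp] at this

lemma IsFibrantObj.of_isFib {X Y : C} {p : X ⟶ Y} (hY : IsFibrantObj An Y) (hp : IsFib An p) :
    IsFibrantObj An X := by
  intro A B f hf a
  obtain ⟨b, hb⟩ := hY f hf (a ≫ p)
  have := hp f hf
  have sq : CommSq a f p b := ⟨hb.symm⟩
  exact ⟨sq.lift, sq.fac_left⟩

lemma IsLeftAnodyneClass.right_of_isFib_of_isWeakEq (hA : IsLeftAnodyneClass E L An)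
    (hE : IsExactCylinder E L) (hW : IsCofGenWFS L R) {X Y : C} {p : X ⟶ Y} (hp : IsFib An p)
    (hw : IsWeakEq E An p) (hY : IsFibrantObj An Y) : R p := by
  have hX := hY.of_isFib hp
  have eX := hA.equivalence_homotopy hE X hX
  rw [hA.isWeakEq_iff hE] at hw
  obtain ⟨s₀, hs₀⟩ := (hw X hX).1 (𝟙 X)
  obtain ⟨h, h₀, h₁⟩ := (hw Y hY).2 (s₀ ≫ p) (𝟙 Y) (by
    simpa using hs₀.postcomp p)
  have := hE.preservesColimits
  let hI : IsInitial (E.I.obj (⊥_ C)) := initialIsInitial.isInitialObj E.I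
  obtain ⟨H, H₀, -, Hp⟩ := hA.exists_lift (hW.initial_mem Y) hp s₀ (hI.to X)
    (initialIsInitial.hom_ext _ _) h h₀ (hI.hom_ext _ _)
  obtain ⟨s, hs'⟩ : ∃ s : Y ⟶ X, E.d1.app Y ≫ H = s := ⟨_, rfl⟩
  have hs : s ≫ p = 𝟙 Y := by rw [← hs', Category.assoc, Hp, h₁]
  obtain ⟨h, h₀, h₁⟩ : E.Homotopy (p ≫ s) (𝟙 X) :=
    eX.trans (eX.symm (Cylinder.Homotopy.precomp ⟨H, H₀, hs'⟩ p)) hs₀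
  have h₀' {Z : C} (f : X ⟶ Z) : E.d0.app X ≫ h ≫ f = p ≫ s ≫ f := by
    rw [← Category.assoc, h₀]
    exact Category.assoc _ _ _
  have h₁' {Z : C} (f : X ⟶ Z) : E.d1.app X ≫ h ≫ f = f := by
    rw [← Category.assoc, h₁]
    exact Category.id_comp _
  obtain ⟨k, k₀, k₁, kp⟩ := hA.exists_homotopy_over hE hp (E.σ.app X ≫ p ≫ s) (h ≫ p ≫ s) h
    (by rw [h₀', E.d0_σ_comp, reassoc_of% hs])
    (by rw [h₀, E.d1_σ_comp])
    (E.I.map (E.σ.app X) ≫ h ≫ p)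
    (by
      refine (E.d0_map_comp (E.σ.app X) (h ≫ p)).trans ?_
      simp only [Category.assoc]
      refine (E.σ.app X ≫= h₀' p).trans ?_
      rfl)
    (by rw [E.map_d0_σ_comp]; simp only [Category.assoc, hs, Category.comp_id])
    (E.map_d1_σ_comp _)
  replace kp : k ≫ p = E.σ.app X ≫ p := kp.trans <|
    (E.d1_map_comp (E.σ.app X) (h ≫ p)).trans (E.σ.app X ≫= h₁' p)
  rw [h₁] at k₁
  rw [h₁'] at k₀
  rw [hW.rlp_eq]
  refine fun K M i hi => ⟨fun {u v} sq => ⟨?_⟩⟩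
  obtain ⟨H, H₀, HI, Hp⟩ := hA.exists_lift hi hp (v ≫ s) (E.I.map u ≫ k)
    (by rw [E.d0_map_comp, k₀, ← Category.assoc, ← sq.w, Category.assoc]) (E.σ.app M ≫ v)
    (by rw [E.d0_σ_comp, Category.assoc, hs, Category.comp_id])
    (by rw [E.map_σ_comp, Category.assoc, kp, E.map_σ_comp, sq.w])
  refine ⟨⟨E.d1.app M ≫ H, ?_, ?_⟩⟩
  · refine (E.d1_map_comp i H).symm.trans ?_
    rw [HI, E.d1_map_comp, k₁]
    exact Category.comp_id _
  · rw [Category.assoc, Hp, E.d1_σ_comp]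

/-- The `An`-fibrations with fibrant codomain. -/
def fibrantFibrations (An : MorphismProperty C) : MorphismProperty C :=
  fun _ Y p => IsFib An p ∧ IsFibrantObj An Y

/-- The trivial cofibrations. -/
def trivialCofibrations (E : Cylinder C) (L An : MorphismProperty C) : MorphismProperty C :=
  fun _ _ i => L i ∧ IsWeakEq E An i

lemma llp_eq (T : MorphismProperty C) : llp T = T.llp := rfl

lemma rlp_eq (T : MorphismProperty C) : rlp T = T.rlp := rfl

lemma IsCofGenWFS.eq_llp (hW : IsCofGenWFS L R) : L = llp R := by
  obtain ⟨S, -, rfl⟩ := hW.exists_generating_set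
  rw [hW.rlp_eq]
  simp only [llp_eq]
  exact (MorphismProperty.llp_rlp_llp _).symm

lemma IsCofGenWFS.left_comp (hW : IsCofGenWFS L R) {X Y Z : C} {f : X ⟶ Y} {g : Y ⟶ Z}
    (hf : L f) (hg : L g) : L (f ≫ g) := by
  rw [hW.eq_llp, llp_eq] at *
  exact MorphismProperty.comp_mem _ _ _ hf hg

lemma IsRetractOf.nonempty {X Y X' Y' : C} {f : X ⟶ Y} {f' : X' ⟶ Y'} (h : IsRetractOf f f') :
    Nonempty (RetractArrow f f') := by
  obtain ⟨i, r, j, s, hir, hjs, hif, hfs⟩ := h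
  exact ⟨{ i := Arrow.homMk i j hif, r := Arrow.homMk r s hfs.symm }⟩

lemma IsRetractOf.llp {T : MorphismProperty C} {X Y X' Y' : C} {f : X ⟶ Y} {f' : X' ⟶ Y'}
    (h : IsRetractOf f f') (hf : llp T f') : llp T f := by
  rw [llp_eq] at *
  exact MorphismProperty.of_retract h.nonempty.some hf

lemma IsRetractOf.rlp {T : MorphismProperty C} {X Y X' Y' : C} {f : X ⟶ Y} {f' : X' ⟶ Y'}
    (h : IsRetractOf f f') (hf : rlp T f') : rlp T f := by
  rw [rlp_eq] at *
  exact MorphismProperty.of_retract h.nonempty.some hf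

lemma isRetractOf_left {X Y Z : C} {f : X ⟶ Y} {i : X ⟶ Z} {p : Z ⟶ Y} (h : i ≫ p = f)
    (hp : HasLiftingProperty f p) : IsRetractOf f i := by
  have sq : CommSq i f p (𝟙 Y) := ⟨by simp [h]⟩
  exact ⟨𝟙 _, 𝟙 _, sq.lift, p, by simp, sq.fac_right, by simp, by simp [h]⟩

lemma isRetractOf_right {X Y Z : C} {f : X ⟶ Y} {i : X ⟶ Z} {p : Z ⟶ Y} (h : i ≫ p = f)
    (hi : HasLiftingProperty i f) : IsRetractOf f p := by
  have sq : CommSq (𝟙 X) i f p := ⟨by simp [h]⟩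
  exact ⟨i, sq.lift, 𝟙 _, 𝟙 _, sq.fac_left, by simp, by simp [h], by simp⟩

/-- A trivial cofibration with fibrant codomain is anodyne, if every morphism factors as an
anodyne morphism followed by a fibration. -/
lemma IsLeftAnodyneClass.trivialCofibrations_hasLiftingProperty
    (hA : IsLeftAnodyneClass E L An) (hE : IsExactCylinder E L) (hW : IsCofGenWFS L R)
    (hfac : ∀ ⦃X Y : C⦄ (f : X ⟶ Y), ∃ (Z : C) (i : X ⟶ Z) (p : Z ⟶ Y),
      An i ∧ IsFib An p ∧ i ≫ p = f) {A B X Y : C} {i : A ⟶ B}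
    (hi : trivialCofibrations E L An i) (hB : IsFibrantObj An B) {p : X ⟶ Y}
    (hp : IsFib An p) : HasLiftingProperty i p := by
  obtain ⟨Z, j, q, hj, hq, rfl⟩ := hfac i
  have hqR := hA.right_of_isFib_of_isWeakEq hE hW hq
    ((hA.isWeakEq hE hj).cancel_left hi.2) hB
  rw [hW.rlp_eq] at hqR
  have hr := isRetractOf_left rfl (hqR _ hi.1)
  exact hr.llp (T := fun _ _ p => IsFib An p) (fun _ _ g hg => hg j hj) p hp

variable (hA : IsLeftAnodyneClass E L An) (hE : IsExactCylinder E L) (hW : IsCofGenWFS L R)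
  (hfac : ∀ ⦃X Y : C⦄ (f : X ⟶ Y), ∃ (Z : C) (i : X ⟶ Z) (p : Z ⟶ Y),
    An i ∧ IsFib An p ∧ i ≫ p = f)
  (hrep : ∀ X : C, ∃ (X' : C) (j : X ⟶ X'), An j ∧ IsFibrantObj An X')

include hA hE hW hfac hrep

lemma trivialCofibrations_iff {A B : C} (i : A ⟶ B) :
    trivialCofibrations E L An i ↔ L i ∧ llp (fibrantFibrations An) i := by
  constructor
  · intro hi
    refine ⟨hi.1, fun X Y p ⟨hp, hY⟩ => ⟨fun {u v} sq => ⟨?_⟩⟩⟩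
    obtain ⟨B', j, hj, hB'⟩ := hrep B
    obtain ⟨v', rfl⟩ := hY j hj v
    have := hA.trivialCofibrations_hasLiftingProperty hE hW hfac (i := i ≫ j)
      ⟨hW.left_comp hi.1 (hA.le _ hj), hi.2.comp (hA.isWeakEq hE hj)⟩ hB' hp
    have sq' : CommSq u (i ≫ j) p v' := ⟨by simpa using sq.w⟩
    exact ⟨⟨j ≫ sq'.lift, (Category.assoc _ _ _).symm.trans sq'.fac_left, by simp⟩⟩
  · rintro ⟨hi, hi'⟩
    refine ⟨hi, ?_⟩
    obtain ⟨A', j, hj, hA'⟩ := hrep A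
    obtain ⟨B', k, hk, hB'⟩ := hrep B
    obtain ⟨g, hg⟩ := hB' j hj (i ≫ k)
    obtain ⟨Z, e, q, he, hq, rfl⟩ := hfac g
    have := hi' q ⟨hq, hB'⟩
    have sq : CommSq (j ≫ e) i q k := ⟨by simpa using hg⟩
    refine IsWeakEq.of_comp_of_comp (g := sq.lift) (h := q) ?_ ?_
    · rw [sq.fac_left]
      exact (hA.isWeakEq hE hj).comp (hA.isWeakEq hE he)
    · rw [sq.fac_right]
      exact hA.isWeakEq hE hk

lemma llp_rlp_le_trivialCofibrations {J : MorphismProperty C}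
    (hJ : J ≤ trivialCofibrations E L An) : llp (rlp J) ≤ trivialCofibrations E L An := by
  intro A B i hi
  have hJ' := fun {A B : C} (i : A ⟶ B) hi =>
    (trivialCofibrations_iff hA hE hW hfac hrep i).1 (hJ i hi)
  rw [trivialCofibrations_iff hA hE hW hfac hrep]
  constructor
  · rw [hW.eq_llp]
    intro X Y p hp
    rw [hW.rlp_eq] at hp
    exact hi p fun _ _ f hf => hp f (hJ' f hf).1
  · exact fun _ _ p hp => hi p fun _ _ f hf => (hJ' f hf).2 p hp

omit hW hfac hrep in
lemma exists_extension_of_trivialCofibrations {A B W : C} (hW : IsFibrantObj An W) {i : A ⟶ B}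
    (hi : trivialCofibrations E L An i) (a : A ⟶ W) : ∃ b : B ⟶ W, i ≫ b = a := by
  obtain ⟨b, h, h₀, h₁⟩ := (((hA.isWeakEq_iff hE i).1 hi.2) W hW).1 a
  obtain ⟨H, -, HI⟩ := hA.exists_extension hi.1 hW b h h₀.symm
  exact ⟨E.d1.app B ≫ H, by
    rw [← Category.assoc, E.d1_naturality', Category.assoc, HI, h₁]⟩

end Homotopy

section Accessible

lemma preservesColimitsOfShape_of_isColimit {D : Type*} [Category* D] {A J : Type*} [Category* A]
    [Category* J] [HasColimitsOfShape J D] {K : J ⥤ C ⥤ D} {c : Cocone K} (hc : IsColimit c)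
    (h : ∀ j, PreservesColimitsOfShape A (K.obj j)) : PreservesColimitsOfShape A c.pt where
  preservesColimit {F} := ⟨fun {cF} hF => by
    let e (X : C) : IsColimit (((evaluation C D).obj X).mapCocone c) :=
      isColimitOfPreserves _ hc
    let t (j : J) : IsColimit ((K.obj j).mapCocone cF) := isColimitOfPreserves _ hF
    have hom_ext {X : C} {Z : D} {f g : c.pt.obj X ⟶ Z}
        (w : ∀ j, (c.ι.app j).app X ≫ f = (c.ι.app j).app X ≫ g) : f = g :=
      (e X).hom_ext w
    have w {i j : J} (φ : i ⟶ j) (X : C) :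
        (K.map φ).app X ≫ (c.ι.app j).app X = (c.ι.app i).app X := by
      rw [← NatTrans.comp_app, c.w]
    let u (s : Cocone (F ⋙ c.pt)) (j : J) : (K.obj j).obj cF.pt ⟶ s.pt :=
      (t j).desc ⟨s.pt,
        { app a := (c.ι.app j).app (F.obj a) ≫ s.ι.app a
          naturality a b φ := by
            have := s.w φ
            have n := (c.ι.app j).naturality (F.map φ)
            dsimp at this n ⊢
            rw [reassoc_of% n, this, Category.comp_id] }⟩
    have hu (s : Cocone (F ⋙ c.pt)) (j : J) (a : A) :
        (K.obj j).map (cF.ι.app a) ≫ u s j = (c.ι.app j).app (F.obj a) ≫ s.ι.app a :=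
      (t j).fac _ a
    have hu' (s : Cocone (F ⋙ c.pt)) {i j : J} (φ : i ⟶ j) :
        (K.map φ).app cF.pt ≫ u s j = u s i :=
      (t i).hom_ext fun a => by
        have := hu s i a
        refine Eq.trans ?_ this.symm
        dsimp
        rw [← w φ, Category.assoc, ← hu, ← Category.assoc, ← Category.assoc,
          (K.map φ).naturality]
    let d (s : Cocone (F ⋙ c.pt)) : c.pt.obj cF.pt ⟶ s.pt :=
      (e cF.pt).desc ⟨s.pt,
        { app j := u s j
          naturality i j φ := by
            dsimp
            rw [hu', Category.comp_id] }⟩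
    have hd (s : Cocone (F ⋙ c.pt)) (j : J) : (c.ι.app j).app cF.pt ≫ d s = u s j :=
      (e cF.pt).fac _ j
    exact ⟨{
      desc s := d s
      fac s a := hom_ext fun j => by
        have n := (c.ι.app j).naturality (cF.ι.app a)
        dsimp at n ⊢
        rw [← reassoc_of% n, hd, hu]
      uniq s m hm := hom_ext fun j => by
        rw [hd]
        refine (t j).hom_ext fun a => ?_
        refine Eq.trans ?_ (hu s j a).symm
        have n := (c.ι.app j).naturality (cF.ι.app a)
        dsimp at n ⊢
        rw [reassoc_of% n, ← hm]
        rfl }⟩⟩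

lemma isCardinalAccessible_of_isColimit {D : Type*} [Category* D] {κ : Cardinal.{v}}
    [Fact κ.IsRegular] {J : Type*} [Category* J] [HasColimitsOfShape J D] {K : J ⥤ C ⥤ D}
    {c : Cocone K} (hc : IsColimit c) (h : ∀ j, (K.obj j).IsCardinalAccessible κ) :
    c.pt.IsCardinalAccessible κ where
  preservesColimitOfShape A _ _ := preservesColimitsOfShape_of_isColimit hc
    fun j => (h j).preservesColimitOfShape A

open SmallObject in
lemma iterationFunctor_isCardinalAccessible {κ : Cardinal.{v}} [Fact κ.IsRegular]
    [HasColimitsOfSize.{v, v} C] {S : C ⥤ C} (ε : 𝟭 C ⟶ S) [hS : S.IsCardinalAccessible κ]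
    (J : Type v) [LinearOrder J] [OrderBot J] [SuccOrder J] [WellFoundedLT J] (j : J) :
    (((SuccStruct.ofNatTrans ε).iterationFunctor J).obj j).IsCardinalAccessible κ := by
  induction j using SuccOrder.limitRecOn with
  | isMin j hj =>
    obtain rfl := hj.eq_bot
    have : (SuccStruct.ofNatTrans ε).X₀.IsCardinalAccessible κ :=
      inferInstanceAs ((𝟭 C).IsCardinalAccessible κ)
    exact Functor.isCardinalAccessible_of_natIso
      ((SuccStruct.ofNatTrans ε).iterationFunctorObjBotIso J).symm κ
  | succ j hj ih =>
    have : ((SuccStruct.ofNatTrans ε).succ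
        (((SuccStruct.ofNatTrans ε).iterationFunctor J).obj j)).IsCardinalAccessible κ :=
      inferInstanceAs ((((SuccStruct.ofNatTrans ε).iterationFunctor J).obj j ⋙
        S).IsCardinalAccessible κ)
    exact Functor.isCardinalAccessible_of_natIso
      ((SuccStruct.ofNatTrans ε).iterationFunctorObjSuccIso j hj).symm κ
  | isSuccLimit j hj ih =>
    exact isCardinalAccessible_of_isColimit (κ := κ)
      (((SuccStruct.ofNatTrans ε).iterationFunctor J).isColimitOfIsWellOrderContinuous j hj)
      (fun i => ih i.1 i.2)

end Accessible

section FibrantReplacement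

variable [HasColimits C] {κ : Cardinal.{v}} [Fact κ.IsRegular]

/-- One step of the small object argument, as a functor. -/
lemma exists_accessible_step {ι : Type v} {A B : ι → C} (f : ∀ i, A i ⟶ B i)
    [∀ i, IsCardinalPresentable (A i) κ] :
    ∃ (S : C ⥤ C) (ε : 𝟭 C ⟶ S), S.IsCardinalAccessible κ ∧
      (MorphismProperty.ofHoms f).rlp.llp.functorCategory C ε ∧
      ∀ (X : C) (i : ι) (a : A i ⟶ X), ∃ b : B i ⟶ S.obj X, f i ≫ b = a ≫ ε.app X := by
  let W := (MorphismProperty.ofHoms f).rlp.llp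
  let PA (i : ι) : C ⥤ C := coyoneda.obj (Opposite.op (A i)) ⋙ sigmaConst.obj (A i)
  let PB (i : ι) : C ⥤ C := coyoneda.obj (Opposite.op (A i)) ⋙ sigmaConst.obj (B i)
  let α (i : ι) : PA i ⟶ PB i := Functor.whiskerLeft _ (sigmaConst.map (f i))
  have hα (i : ι) : W.functorCategory C (α i) := fun X => by
    have hf : W (f i) := MorphismProperty.le_llp_rlp _ _ ⟨i⟩
    exact MorphismProperty.colimMap _ fun _ => hf
  let β (i : ι) : PA i ⟶ 𝟭 C := (sigmaConstAdj (A i)).counit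
  have hPA (i : ι) : (PA i).IsCardinalAccessible κ := ⟨fun J _ _ => by
    have : PreservesColimitsOfSize.{v, v} (sigmaConst.{v}.obj (A i)) :=
      (sigmaConstAdj (A i)).leftAdjoint_preservesColimits
    have : PreservesColimitsOfShape J (coyoneda.obj (Opposite.op (A i))) :=
      preservesColimitsOfShape_of_isCardinalPresentable (A i) κ J
    exact comp_preservesColimitsOfShape _ _⟩
  have hPB (i : ι) : (PB i).IsCardinalAccessible κ := ⟨fun J _ _ => by
    have : PreservesColimitsOfSize.{v, v} (sigmaConst.{v}.obj (B i)) :=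
      (sigmaConstAdj (B i)).leftAdjoint_preservesColimits
    have : PreservesColimitsOfShape J (coyoneda.obj (Opposite.op (A i))) :=
      preservesColimitsOfShape_of_isCardinalPresentable (A i) κ J
    exact comp_preservesColimitsOfShape _ _⟩
  let a : ∐ PA ⟶ ∐ PB := Limits.Sigma.map α
  let b : ∐ PA ⟶ 𝟭 C := Limits.Sigma.desc β
  have hA : (∐ PA).IsCardinalAccessible κ :=
    isCardinalAccessible_of_isColimit (colimit.isColimit (Discrete.functor PA)) fun i => hPA i.as
  have hB : (∐ PB).IsCardinalAccessible κ :=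
    isCardinalAccessible_of_isColimit (colimit.isColimit (Discrete.functor PB)) fun i => hPB i.as
  refine ⟨pushout a b, pushout.inr a b, ?_, ?_, ?_⟩
  · refine isCardinalAccessible_of_isColimit (colimit.isColimit (span a b)) ?_
    rintro (_ | _ | _)
    · exact hA
    · exact hB
    · exact inferInstanceAs ((𝟭 C).IsCardinalAccessible κ)
  · have ha : W.functorCategory C a := MorphismProperty.colimMap _ fun i => hα i.as
    exact MorphismProperty.pushout_inr _ _ ha
  · intro X i x
    have h₁ : (Sigma.ι PA i).app X ≫ a.app X = (α i).app X ≫ (Sigma.ι PB i).app X := by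
      rw [← NatTrans.comp_app, ← NatTrans.comp_app]
      simp [a]
    have h₂ : (Sigma.ι PA i).app X ≫ b.app X = (β i).app X := by
      rw [← NatTrans.comp_app]
      simp [b]
    have h₃ : a.app X ≫ (pushout.inl a b).app X = b.app X ≫ (pushout.inr a b).app X := by
      rw [← NatTrans.comp_app, ← NatTrans.comp_app, pushout.condition]
    have h₄ : Sigma.ι (fun _ : A i ⟶ X => A i) x ≫ (β i).app X = x := by
      simp [β, sigmaConstAdj]
    have h₅ : Sigma.ι (fun _ : A i ⟶ X => A i) x ≫ (α i).app X =
        f i ≫ Sigma.ι (fun _ : A i ⟶ X => B i) x := by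
      simp [α, sigmaConst]
    refine ⟨Sigma.ι (fun _ : A i ⟶ X => B i) x ≫ (Sigma.ι PB i).app X ≫
      (pushout.inl a b).app X, ?_⟩
    rw [← reassoc_of% h₅, ← reassoc_of% h₁, h₃, reassoc_of% h₂, reassoc_of% h₄]

end FibrantReplacement

section FibrantReplacement

variable [HasColimits C] {κ : Cardinal.{v}} [Fact κ.IsRegular]

open SmallObject in
/-- An accessible functorial fibrant replacement for a family of maps with presentable
domains. -/
lemma exists_accessible_replacement {ι : Type v} {A B : ι → C} (f : ∀ i, A i ⟶ B i)
    [∀ i, IsCardinalPresentable (A i) κ] :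
    ∃ (T : C ⥤ C) (η : 𝟭 C ⟶ T), T.IsCardinalAccessible κ ∧
      (∀ X, (MorphismProperty.ofHoms f).rlp.llp (η.app X)) ∧
      ∀ (X : C) (i : ι) (a : A i ⟶ T.obj X), ∃ b : B i ⟶ T.obj X, f i ≫ b = a := by
  obtain ⟨S, ε, hS, hε, hlift⟩ := exists_accessible_step (κ := κ) f
  have : Nonempty κ.ord.ToType := by
    simpa using Cardinal.IsRegular.ne_zero (Fact.out : κ.IsRegular)
  let _ := WellFoundedLT.toOrderBot κ.ord.ToType
  have : NoMaxOrder κ.ord.ToType := Cardinal.noMaxOrder (Cardinal.IsRegular.aleph0_le Fact.out)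
  have hfil := isFiltered_of_isCardinalFiltered κ.ord.ToType κ
  let Φ := SuccStruct.ofNatTrans ε
  let J := κ.ord.ToType
  let F := Φ.iterationFunctor J
  let W := (MorphismProperty.ofHoms f).rlp.llp
  have hc : IsColimit (Φ.iterationCocone J) := Φ.isColimitIterationCocone J
  have hacc : (Φ.iteration J).IsCardinalAccessible κ :=
    isCardinalAccessible_of_isColimit hc
      fun j => iterationFunctor_isCardinalAccessible ε J j
  refine ⟨Φ.iteration J, Φ.ιIteration J, hacc, ?_, ?_⟩
  · have hle : Φ.prop ≤ W.functorCategory C := by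
      rintro _ _ _ ⟨⟩ X
      exact hε _
    exact (W.functorCategory C).transfiniteCompositionsOfShape_le J _
      ⟨(Φ.transfiniteCompositionOfShapeιIteration J).ofLE hle⟩
  · intro X i a
    have hcX : IsColimit (((evaluation C C).obj X).mapCocone (Φ.iterationCocone J)) :=
      isColimitOfPreserves _ hc
    obtain ⟨j, a', ha'⟩ := IsCardinalPresentable.exists_hom_of_isColimit κ hcX a
    obtain ⟨b, hb⟩ := hlift _ i a'
    have hj : ¬ IsMax j := not_isMax j
    refine ⟨b ≫ (Φ.iterationFunctorObjSuccIso j hj).inv.app X ≫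
      ((Φ.iterationCocone J).ι.app (Order.succ j)).app X, ?_⟩
    have h₁ := congr_app (Φ.iterationFunctor_map_succ j hj) X
    have h₂ := congr_app ((Φ.iterationCocone J).w (homOfLE (Order.le_succ j))) X
    rw [reassoc_of% hb, ← ha']
    rw [NatTrans.comp_app] at h₁ h₂
    refine Eq.trans ?_ (a' ≫= h₂)
    rw [h₁]
    exact congrArg (a' ≫ ·) (Category.assoc _ _ _).symm

end FibrantReplacement

section Presentability

lemma isCardinalFiltered_of_paper (J : Cat.{v, v}) (κ : Cardinal.{v}) [Fact κ.IsRegular]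
    (h : IsCardinalFiltered J κ) : CategoryTheory.IsCardinalFiltered J κ where
  nonempty_cocone {A} _ F hA :=
    h (Cat.of A) ((hasCardinalLT_iff_cardinal_mk_lt _ _).1 hA) F

lemma paper_isCardinalFiltered (J : Type v) [SmallCategory J] (κ : Cardinal.{v})
    [Fact κ.IsRegular] [CategoryTheory.IsCardinalFiltered J κ] :
    IsCardinalFiltered (Cat.of J) κ :=
  fun K hK F => by
    let F' : K ⥤ J := F
    exact CategoryTheory.IsCardinalFiltered.nonempty_cocone F'
      ((hasCardinalLT_iff_cardinal_mk_lt _ κ).2 hK)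

lemma IsPresentableObj.isCardinalPresentable {κ : Cardinal.{v}} [Fact κ.IsRegular] {X : C}
    (h : IsPresentableObj κ X) : IsCardinalPresentable X κ where
  preservesColimitOfShape J _ _ := h (Cat.of J) (paper_isCardinalFiltered J κ)

instance LocallyPresentable.isLocallyPresentable [LocallyPresentable C] :
    IsLocallyPresentable.{v} C where
  exists_cardinal := by
    obtain ⟨κ, hκ, ι, G, hG, hX⟩ := LocallyPresentable.exists_presentable_generator (C := C)
    have : Fact κ.IsRegular := ⟨hκ⟩
    have hP : (ObjectProperty.ofObj G).isoClosure.IsCardinalFilteredGenerator κ := by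
      refine ⟨?_, fun X => ?_⟩
      · rw [ObjectProperty.isoClosure_le_iff]
        rintro _ ⟨i⟩
        exact (hG i).isCardinalPresentable
      · obtain ⟨J, F, c, hJ, ⟨hc⟩, hF, ⟨e⟩⟩ := hX X
        refine ⟨J, inferInstance, isCardinalFiltered_of_paper J κ hJ, ⟨?_⟩⟩
        refine ⟨⟨F, c.ι ≫ (Functor.const J).map e.hom,
          IsColimit.ofIsoColimit hc (Cocone.ext e)⟩, fun j => ?_⟩
        obtain ⟨i, ⟨e'⟩⟩ := hF j
        exact ⟨_, ⟨i⟩, ⟨e'⟩⟩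
    have := hP.hasCardinalFilteredGenerator
    exact ⟨κ, inferInstance, { }⟩

lemma exists_regular_cardinal_presentable [IsLocallyPresentable.{v} C] {ι : Type v} (Z : ι → C)
    (κ₀ : Cardinal.{v}) :
    ∃ (κ : Cardinal.{v}) (_ : Fact κ.IsRegular), κ₀ ≤ κ ∧ ∀ i, IsCardinalPresentable (Z i) κ := by
  have hZ (i : ι) : ∃ (κ : Cardinal.{v}) (_ : Fact κ.IsRegular), IsCardinalPresentable (Z i) κ :=
    (inferInstance : IsPresentable.{v} (Z i)).exists_cardinal
  choose κ' hκ' hZ using hZ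
  obtain ⟨κ, hκ, hle⟩ := HasCardinalLT.exists_regular_cardinal_forall.{v}
    (fun o : Option ι => (o.elim κ₀ κ').ord.ToType)
  have hle (o : Option ι) : o.elim κ₀ κ' ≤ κ :=
    le_of_lt (by simpa [hasCardinalLT_iff_cardinal_mk_lt] using hle o)
  have : Fact κ.IsRegular := ⟨hκ⟩
  exact ⟨κ, inferInstance, hle none, fun i =>
    isCardinalPresentable_of_le _ (show κ' i ≤ κ from hle (some i))⟩

/-- A cocontinuous functor between locally presentable categories preserves `κ`-presentable
objects for all large enough regular cardinals `κ`. -/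
lemma exists_cardinal_preserves {A : Type u'} [Category.{v} A] [IsLocallyPresentable.{v} A]
    [IsLocallyPresentable.{v} C] (I : A ⥤ C) [PreservesColimits I] :
    ∃ κ₀ : Cardinal.{v}, ∀ (κ : Cardinal.{v}) [Fact κ.IsRegular], κ₀ ≤ κ →
      ∀ X : A, IsCardinalPresentable X κ → IsCardinalPresentable (I.obj X) κ := by
  obtain ⟨κ₁, _, hκ₁⟩ := IsLocallyPresentable.exists_cardinal.{v} A
  obtain ⟨P, _, hP, hPκ₁⟩ :=
    (IsCardinalLocallyPresentable.iff_exists_isStrongGenerator A κ₁).1 inferInstance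
  have : Small.{v} (Subtype P) := inferInstanceAs (ObjectProperty.Small.{v} P)
  let G (i : Shrink.{v} (Subtype P)) : A := ((equivShrink _).symm i).1
  obtain ⟨κ₀, _, hle, hZ⟩ := exists_regular_cardinal_presentable (fun i => I.obj (G i)) κ₁
  refine ⟨κ₀, fun κ _ hκ => ?_⟩
  have hPκ := hPκ₁.trans (isCardinalPresentable_monotone A (hle.trans hκ))
  suffices isCardinalPresentable A κ ≤ (isCardinalPresentable C κ).inverseImage I from this
  rw [IsStrongGenerator.colimitsCardinalClosure_eq_isCardinalPresentable hP hPκ]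
  refine P.colimitsCardinalClosure_le κ (fun J _ hJ => ?_) fun X hX => ?_
  · have : HasLimitsOfShape Jᵒᵖ (Type v) := inferInstance
    have := isClosedUnderColimitsOfShape_isCardinalPresentable C (κ := κ) (J := J) hJ
    exact { colimitsOfShape_le := by
              rintro X ⟨p⟩
              exact ObjectProperty.prop_of_isColimit _ (isColimitOfPreserves I p.isColimit)
                fun j => p.prop_diag_obj j }
  · have := hZ (equivShrink _ ⟨X, hX⟩)
    simp only [G, Equiv.symm_apply_apply] at this
    exact isCardinalPresentable_of_le _ hκ

end Presentability

section Arrow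

/-- Morphisms from an identity in the category of arrows. -/
def arrowIdHomEquiv (G : C) (w : Arrow C) : (G ⟶ w.left) ≃ (Arrow.mk (𝟙 G) ⟶ w) where
  toFun f := Arrow.homMk f (f ≫ w.hom) (Category.id_comp _).symm
  invFun f := f.left
  left_inv _ := rfl
  right_inv f := Arrow.hom_ext _ _ rfl (f.w.trans (Category.id_comp _))

/-- Morphisms in the category of arrows from a morphism with initial source. -/
noncomputable def arrowInitialHomEquiv [HasInitial C] (G : C) (w : Arrow C) :
    (G ⟶ w.right) ≃ (Arrow.mk (initial.to G) ⟶ w) where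
  toFun f := Arrow.homMk (initial.to _) f (initial.hom_ext _ _)
  invFun f := f.right
  left_inv _ := rfl
  right_inv _ := Arrow.hom_ext _ _ (initial.hom_ext _ _) rfl

lemma isCardinalPresentable_arrow_id (κ : Cardinal.{v}) [Fact κ.IsRegular] [HasColimits C]
    (G : C) [IsCardinalPresentable G κ] : IsCardinalPresentable (Arrow.mk (𝟙 G)) κ := by
  let e : Arrow.leftFunc ⋙ coyoneda.obj (Opposite.op G) ≅
      coyoneda.obj (Opposite.op (Arrow.mk (𝟙 G))) :=
    NatIso.ofComponents (fun w => (arrowIdHomEquiv G w).toIso) fun {w w'} φ => by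
      ext x
      exact Arrow.hom_ext _ _ rfl (by
        have := x ≫= φ.w
        exact (Category.assoc _ _ _).trans (this.trans (Category.assoc _ _ _).symm))
  have : PreservesColimits (Arrow.leftFunc : Arrow C ⥤ C) := ⟨inferInstance⟩
  have : (Arrow.leftFunc ⋙ coyoneda.obj (Opposite.op G)).IsCardinalAccessible κ := inferInstance
  exact Functor.isCardinalAccessible_of_natIso e κ

lemma isCardinalPresentable_arrow_initial (κ : Cardinal.{v}) [Fact κ.IsRegular] [HasColimits C]
    (G : C) [IsCardinalPresentable G κ] :
    IsCardinalPresentable (Arrow.mk (initial.to G)) κ := by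
  let e : Arrow.rightFunc ⋙ coyoneda.obj (Opposite.op G) ≅
      coyoneda.obj (Opposite.op (Arrow.mk (initial.to G))) :=
    NatIso.ofComponents (fun w => (arrowInitialHomEquiv G w).toIso) fun {w w'} φ => by
      ext x
      exact Arrow.hom_ext _ _ (initial.hom_ext _ _) rfl
  have : PreservesColimits (Arrow.rightFunc : Arrow C ⥤ C) := ⟨inferInstance⟩
  have : (Arrow.rightFunc ⋙ coyoneda.obj (Opposite.op G)).IsCardinalAccessible κ := inferInstance
  exact Functor.isCardinalAccessible_of_natIso e κ

lemma arrow_isStrongGenerator [HasColimits C] {P : ObjectProperty C} (hP : P.IsStrongGenerator)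
    {Q : ObjectProperty (Arrow C)} (hid : ∀ G, P G → Q (Arrow.mk (𝟙 G)))
    (hinitial : ∀ G, P G → Q (Arrow.mk (initial.to G))) : Q.IsStrongGenerator := by
  rw [ObjectProperty.isStrongGenerator_iff] at hP ⊢
  obtain ⟨hP₁, hP₂⟩ := hP
  refine ⟨fun w w' f g h => ?_, fun w w' i _ hi => ?_⟩
  · apply Arrow.hom_ext
    · refine hP₁ _ _ fun G hG a => ?_
      exact congrArg CommaMorphism.left
        (h _ (hid G hG) (arrowIdHomEquiv G w a))
    · refine hP₁ _ _ fun G hG a => ?_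
      exact congrArg CommaMorphism.right
        (h _ (hinitial G hG) (arrowInitialHomEquiv G w a))
  · have : Mono i.left := ⟨fun {Z} a b hab => (arrowIdHomEquiv Z w).injective <|
      (cancel_mono i).1 <| (arrowIdHomEquiv Z w').symm.injective hab⟩
    have : Mono i.right := ⟨fun {Z} a b hab => (arrowInitialHomEquiv Z w).injective <|
      (cancel_mono i).1 <| (arrowInitialHomEquiv Z w').symm.injective hab⟩
    have hl : IsIso i.left := hP₂ _ fun G hG a => by
      obtain ⟨b, hb⟩ := hi _ (hid G hG) (arrowIdHomEquiv G w' a)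
      exact ⟨b.left, congrArg CommaMorphism.left hb⟩
    have hr : IsIso i.right := hP₂ _ fun G hG a => by
      obtain ⟨b, hb⟩ := hi _ (hinitial G hG)
        (arrowInitialHomEquiv G w' a)
      exact ⟨b.right, congrArg CommaMorphism.right hb⟩
    exact Arrow.isIso_of_isIso_left_of_isIso_right i

instance [HasColimits C] [IsLocallyPresentable.{v} C] : IsLocallyPresentable.{v} (Arrow C) where
  exists_cardinal := by
    obtain ⟨κ, _, _⟩ := IsLocallyPresentable.exists_cardinal.{v} C
    obtain ⟨P, _, hP, hPκ⟩ :=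
      (IsCardinalLocallyPresentable.iff_exists_isStrongGenerator C κ).1 inferInstance
    have : Small.{v} (Subtype P) := inferInstanceAs (ObjectProperty.Small.{v} P)
    refine ⟨κ, inferInstance, ?_⟩
    rw [IsCardinalLocallyPresentable.iff_exists_isStrongGenerator]
    refine ⟨ObjectProperty.ofObj (Sum.elim (fun G : Subtype P => Arrow.mk (𝟙 G.1))
      fun G : Subtype P => Arrow.mk (initial.to G.1)), inferInstance,
      arrow_isStrongGenerator hP
        (fun G hG => ObjectProperty.ofObj_apply _ (Sum.inl (⟨G, hG⟩ : Subtype P)))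
        (fun G hG => ObjectProperty.ofObj_apply _ (Sum.inr (⟨G, hG⟩ : Subtype P))), ?_⟩
    rintro _ ⟨⟨G, hG⟩ | ⟨G, hG⟩⟩
    · have : IsCardinalPresentable G κ := hPκ _ hG
      exact isCardinalPresentable_arrow_id κ G
    · have : IsCardinalPresentable G κ := hPκ _ hG
      exact isCardinalPresentable_arrow_initial κ G

end Arrow

section HomotopyInverse

/-- A map `φ : w ⟶ w'` of arrows, together with a homotopy inverse of `w` relative to `φ`, up to
the functorial replacement `η : 𝟭 C ⟶ T`. -/
@[ext]
structure HomotopyInverse (E : Cylinder C) {T : C ⥤ C} (η : 𝟭 C ⟶ T) (w w' : Arrow C) where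
  φ : w ⟶ w'
  g : w.right ⟶ T.obj w'.left
  h : E.I.obj w.left ⟶ T.obj w'.left
  k : E.I.obj w.right ⟶ T.obj w'.right
  d0_h : E.d0.app w.left ≫ h = η.app w.left ≫ T.map φ.left
  d1_h : E.d1.app w.left ≫ h = w.hom ≫ g
  d0_k : E.d0.app w.right ≫ k = η.app w.right ≫ T.map φ.right
  d1_k : E.d1.app w.right ≫ k = g ≫ T.map w'.hom

namespace HomotopyInverse

variable [HasColimits C] {E : Cylinder C} {T : C ⥤ C} {η : 𝟭 C ⟶ T}

lemma η_map_comp (η : 𝟭 C ⟶ T) {X Y Z : C} (f : X ⟶ Y) (g : T.obj Y ⟶ Z) :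
    η.app X ≫ T.map f ≫ g = f ≫ η.app Y ≫ g := by
  have := η.naturality f
  simp only [Functor.id_map] at this
  exact ((Category.assoc _ _ _).symm.trans (this.symm =≫ g)).trans (Category.assoc _ _ _)

/-- Precomposition with a map of arrows. -/
@[simps]
def pre {w₀ w w' : Arrow C} (ψ : w₀ ⟶ w) (m : HomotopyInverse E η w w') :
    HomotopyInverse E η w₀ w' where
  φ := ψ ≫ m.φ
  g := ψ.right ≫ m.g
  h := E.I.map ψ.left ≫ m.h
  k := E.I.map ψ.right ≫ m.k
  d0_h := by
    refine (E.d0_map_comp _ _).trans ?_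
    rw [Arrow.comp_left, T.map_comp]
    refine Eq.trans ?_ (η_map_comp η _ _).symm
    exact ψ.left ≫= m.d0_h
  d1_h := by
    refine (E.d1_map_comp _ _).trans ((ψ.left ≫= m.d1_h).trans ?_)
    simp
  d0_k := by
    refine (E.d0_map_comp _ _).trans ?_
    rw [Arrow.comp_right, T.map_comp]
    refine Eq.trans ?_ (η_map_comp η _ _).symm
    exact ψ.right ≫= m.d0_k
  d1_k := by
    refine (E.d1_map_comp _ _).trans ((ψ.right ≫= m.d1_k).trans ?_)
    simp

/-- Postcomposition with a map of arrows. -/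
@[simps]
def post {w w' w'' : Arrow C} (m : HomotopyInverse E η w w') (ψ : w' ⟶ w'') :
    HomotopyInverse E η w w'' where
  φ := m.φ ≫ ψ
  g := m.g ≫ T.map ψ.left
  h := m.h ≫ T.map ψ.left
  k := m.k ≫ T.map ψ.right
  d0_h := by rw [reassoc_of% m.d0_h, Arrow.comp_left, T.map_comp]
  d1_h := by rw [reassoc_of% m.d1_h]
  d0_k := by rw [reassoc_of% m.d0_k, Arrow.comp_right, T.map_comp]
  d1_k := by
    rw [reassoc_of% m.d1_k, Category.assoc, ← T.map_comp, ← T.map_comp, Arrow.w]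

lemma pre_post {w₀ w w' w'' : Arrow C} (ψ : w₀ ⟶ w) (m : HomotopyInverse E η w w')
    (χ : w' ⟶ w'') : (m.pre ψ).post χ = (m.post χ).pre ψ := by
  ext <;> simp

lemma pre_pre {w₀ w₁ w w' : Arrow C} (χ : w₀ ⟶ w₁) (ψ : w₁ ⟶ w) (m : HomotopyInverse E η w w') :
    (m.pre ψ).pre χ = m.pre (χ ≫ ψ) := by
  ext <;> simp

lemma post_post {w w' w'' w₃ : Arrow C} (m : HomotopyInverse E η w w') (χ : w' ⟶ w'')
    (ψ : w'' ⟶ w₃) : (m.post χ).post ψ = m.post (χ ≫ ψ) := by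
  ext <;> simp

lemma pre_id {w w' : Arrow C} (m : HomotopyInverse E η w w') : m.pre (𝟙 w) = m := by
  ext <;> simp

/-- Homotopy inverses glue along colimits in the source. -/
lemma exists_of_isColimit {J : Type w₁} [Category.{w₂} J] [HasColimitsOfShape J C]
    [PreservesColimitsOfShape J E.I]
    {F : J ⥤ Arrow C} {c : Cocone F} (hc : IsColimit c) {w' : Arrow C}
    (m : ∀ j, HomotopyInverse E η (F.obj j) w')
    (hm : ∀ {i j} (u : i ⟶ j), (m j).pre (F.map u) = m i) :
    ∃ m₀ : HomotopyInverse E η c.pt w', ∀ j, m₀.pre (c.ι.app j) = m j := by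
  have hl := isColimitOfPreserves Arrow.leftFunc hc
  have hr := isColimitOfPreserves Arrow.rightFunc hc
  have hIl := isColimitOfPreserves E.I hl
  have hIr := isColimitOfPreserves E.I hr
  let φ : c.pt ⟶ w' := hc.desc ⟨w', { app j := (m j).φ
                                      naturality i j u := by
                                        simpa using congrArg HomotopyInverse.φ (hm u) }⟩
  have hφ (j) : c.ι.app j ≫ φ = (m j).φ := hc.fac _ j
  let g : c.pt.right ⟶ T.obj w'.left :=
    hr.desc ⟨_, { app j := (m j).g
                  naturality i j u :=
                    (congrArg HomotopyInverse.g (hm u)).trans (Category.comp_id _).symm }⟩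
  have hg (j) : (c.ι.app j).right ≫ g = (m j).g := hr.fac _ j
  let h : E.I.obj c.pt.left ⟶ T.obj w'.left :=
    hIl.desc ⟨_, { app j := (m j).h
                   naturality i j u :=
                     (congrArg HomotopyInverse.h (hm u)).trans (Category.comp_id _).symm }⟩
  have hh (j) : E.I.map (c.ι.app j).left ≫ h = (m j).h := hIl.fac _ j
  let k : E.I.obj c.pt.right ⟶ T.obj w'.right :=
    hIr.desc ⟨_, { app j := (m j).k
                   naturality i j u :=
                     (congrArg HomotopyInverse.k (hm u)).trans (Category.comp_id _).symm }⟩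
  have hk (j) : E.I.map (c.ι.app j).right ≫ k = (m j).k := hIr.fac _ j
  refine ⟨⟨φ, g, h, k, hl.hom_ext fun j => ?_, hl.hom_ext fun j => ?_, hr.hom_ext fun j => ?_,
    hr.hom_ext fun j => ?_⟩, fun j => by ext1 <;> simp [hφ, hg, hh, hk]⟩
  · change (c.ι.app j).left ≫ E.d0.app _ ≫ h = (c.ι.app j).left ≫ η.app _ ≫ T.map φ.left
    refine (E.d0_map_comp _ _).symm.trans ?_
    refine Eq.trans ?_ (η_map_comp η _ _)
    rw [hh, ← T.map_comp, ← Arrow.comp_left, hφ, (m j).d0_h]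
  · change (c.ι.app j).left ≫ E.d1.app _ ≫ h = (c.ι.app j).left ≫ c.pt.hom ≫ g
    refine (E.d1_map_comp _ _).symm.trans ?_
    rw [hh, (m j).d1_h, ← hg]
    exact (reassoc_of% (Arrow.w (c.ι.app j)).symm) g
  · change (c.ι.app j).right ≫ E.d0.app _ ≫ k = (c.ι.app j).right ≫ η.app _ ≫ T.map φ.right
    refine (E.d0_map_comp _ _).symm.trans ?_
    refine Eq.trans ?_ (η_map_comp η _ _)
    rw [hk, ← T.map_comp, ← Arrow.comp_right, hφ, (m j).d0_k]
  · change (c.ι.app j).right ≫ E.d1.app _ ≫ k = (c.ι.app j).right ≫ g ≫ T.map w'.hom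
    refine (E.d1_map_comp _ _).symm.trans ?_
    rw [hk, (m j).d1_k, reassoc_of% hg]

end HomotopyInverse

end HomotopyInverse

lemma exists_common_refinement {J : Type w₁} [Category.{w₂} J] [IsFiltered J] {j j₁ j₂ j₃ j₄ : J}
    (u₁ : j ⟶ j₁) (u₂ : j ⟶ j₂) (u₃ : j ⟶ j₃) (u₄ : j ⟶ j₄) :
    ∃ (k : J) (u : j ⟶ k) (v₁ : j₁ ⟶ k) (v₂ : j₂ ⟶ k) (v₃ : j₃ ⟶ k) (v₄ : j₄ ⟶ k),
      u₁ ≫ v₁ = u ∧ u₂ ≫ v₂ = u ∧ u₃ ≫ v₃ = u ∧ u₄ ≫ v₄ = u := by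
  obtain ⟨a, a₁, a₂, ha⟩ := IsFiltered.span u₁ u₂
  obtain ⟨b, b₁, b₂, hb⟩ := IsFiltered.span u₃ u₄
  obtain ⟨k, c, d, hk⟩ := IsFiltered.span (u₁ ≫ a₁) (u₃ ≫ b₁)
  refine ⟨k, u₁ ≫ a₁ ≫ c, a₁ ≫ c, a₂ ≫ c, b₁ ≫ d, b₂ ≫ d, rfl, ?_, ?_, ?_⟩
  · rw [reassoc_of% ha]
  · simpa using hk.symm
  · simpa [reassoc_of% hb] using hk.symm

namespace HomotopyInverse

variable [HasColimits C] {E : Cylinder C} {T : C ⥤ C} {η : 𝟭 C ⟶ T}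

section Presentable

variable (κ : Cardinal.{v}) [Fact κ.IsRegular] {w : Arrow C} [IsCardinalPresentable w κ]
  [IsCardinalPresentable w.left κ] [IsCardinalPresentable w.right κ]
  [IsCardinalPresentable (E.I.obj w.left) κ] [IsCardinalPresentable (E.I.obj w.right) κ]
  [T.IsCardinalAccessible κ] {J : Type v} [SmallCategory J] [CategoryTheory.IsCardinalFiltered J κ]
  {D : J ⥤ Arrow C} {c : Cocone D} (hc : IsColimit c)

include κ hc

lemma exists_post_map_eq {j : J} (m m' : HomotopyInverse E η w (D.obj j))
    (h : m.post (c.ι.app j) = m'.post (c.ι.app j)) :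
    ∃ (k : J) (u : j ⟶ k), m.post (D.map u) = m'.post (D.map u) := by
  have := isFiltered_of_isCardinalFiltered J κ
  have := T.preservesColimitsOfShape_of_isCardinalAccessible κ J
  have hl := isColimitOfPreserves T (isColimitOfPreserves Arrow.leftFunc hc)
  have hr := isColimitOfPreserves T (isColimitOfPreserves Arrow.rightFunc hc)
  obtain ⟨j₁, u₁, h₁⟩ := IsCardinalPresentable.exists_eq_of_isColimit' κ hc m.φ m'.φ
    (congrArg HomotopyInverse.φ h)
  obtain ⟨j₂, u₂, h₂⟩ := IsCardinalPresentable.exists_eq_of_isColimit' κ hl m.g m'.g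
    (congrArg HomotopyInverse.g h)
  obtain ⟨j₃, u₃, h₃⟩ := IsCardinalPresentable.exists_eq_of_isColimit' κ hl m.h m'.h
    (congrArg HomotopyInverse.h h)
  obtain ⟨j₄, u₄, h₄⟩ := IsCardinalPresentable.exists_eq_of_isColimit' κ hr m.k m'.k
    (congrArg HomotopyInverse.k h)
  replace h₂ : m.g ≫ T.map (D.map u₂).left = m'.g ≫ T.map (D.map u₂).left := h₂
  replace h₃ : m.h ≫ T.map (D.map u₃).left = m'.h ≫ T.map (D.map u₃).left := h₃
  replace h₄ : m.k ≫ T.map (D.map u₄).right = m'.k ≫ T.map (D.map u₄).right := h₄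
  obtain ⟨k, u, v₁, v₂, v₃, v₄, e₁, e₂, e₃, e₄⟩ := exists_common_refinement u₁ u₂ u₃ u₄
  refine ⟨k, u, ?_⟩
  ext1
  · change m.φ ≫ D.map u = m'.φ ≫ D.map u
    rw [← e₁, D.map_comp, reassoc_of% h₁]
  · change m.g ≫ T.map (D.map u).left = m'.g ≫ T.map (D.map u).left
    rw [← e₂, D.map_comp, Arrow.comp_left, T.map_comp, reassoc_of% h₂]
  · change m.h ≫ T.map (D.map u).left = m'.h ≫ T.map (D.map u).left
    rw [← e₃, D.map_comp, Arrow.comp_left, T.map_comp, reassoc_of% h₃]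
  · change m.k ≫ T.map (D.map u).right = m'.k ≫ T.map (D.map u).right
    rw [← e₄, D.map_comp, Arrow.comp_right, T.map_comp, reassoc_of% h₄]

lemma exists_post_eq (m : HomotopyInverse E η w c.pt) :
    ∃ (j : J) (m' : HomotopyInverse E η w (D.obj j)), m'.post (c.ι.app j) = m := by
  have := isFiltered_of_isCardinalFiltered J κ
  have := T.preservesColimitsOfShape_of_isCardinalAccessible κ J
  have hl := isColimitOfPreserves T (isColimitOfPreserves Arrow.leftFunc hc)
  have hr := isColimitOfPreserves T (isColimitOfPreserves Arrow.rightFunc hc)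
  obtain ⟨j, φ, g, h, k, hφ, hg, hh, hk⟩ : ∃ (j : J) (φ : w ⟶ D.obj j)
      (g : w.right ⟶ T.obj (D.obj j).left) (h : E.I.obj w.left ⟶ T.obj (D.obj j).left)
      (k : E.I.obj w.right ⟶ T.obj (D.obj j).right),
      φ ≫ c.ι.app j = m.φ ∧ g ≫ T.map (c.ι.app j).left = m.g ∧
      h ≫ T.map (c.ι.app j).left = m.h ∧ k ≫ T.map (c.ι.app j).right = m.k := by
    obtain ⟨j₁, φ, hφ⟩ := IsCardinalPresentable.exists_hom_of_isColimit κ hc m.φ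
    obtain ⟨j₂, (g : _ ⟶ T.obj (D.obj j₂).left), hg⟩ :=
      IsCardinalPresentable.exists_hom_of_isColimit κ hl m.g
    obtain ⟨j₃, (h : _ ⟶ T.obj (D.obj j₃).left), hh⟩ :=
      IsCardinalPresentable.exists_hom_of_isColimit κ hl m.h
    obtain ⟨j₄, (k : _ ⟶ T.obj (D.obj j₄).right), hk⟩ :=
      IsCardinalPresentable.exists_hom_of_isColimit κ hr m.k
    replace hg : g ≫ T.map (c.ι.app j₂).left = m.g := hg
    replace hh : h ≫ T.map (c.ι.app j₃).left = m.h := hh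
    replace hk : k ≫ T.map (c.ι.app j₄).right = m.k := hk
    obtain ⟨j, v₁, v₂, v₃, v₄⟩ : ∃ j, ∃ (_ : j₁ ⟶ j) (_ : j₂ ⟶ j) (_ : j₃ ⟶ j), Nonempty (j₄ ⟶ j) :=
      ⟨IsFiltered.max (IsFiltered.max j₁ j₂) (IsFiltered.max j₃ j₄),
        IsFiltered.leftToMax _ _ ≫ IsFiltered.leftToMax _ _,
        IsFiltered.rightToMax _ _ ≫ IsFiltered.leftToMax _ _,
        IsFiltered.leftToMax _ _ ≫ IsFiltered.rightToMax _ _,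
        ⟨IsFiltered.rightToMax _ _ ≫ IsFiltered.rightToMax _ _⟩⟩
    obtain ⟨v₄⟩ := v₄
    refine ⟨j, φ ≫ D.map v₁, g ≫ T.map (D.map v₂).left, h ≫ T.map (D.map v₃).left,
      k ≫ T.map (D.map v₄).right, ?_, ?_, ?_, ?_⟩
    · rw [Category.assoc, c.w, hφ]
    · rw [Category.assoc, ← T.map_comp, ← Arrow.comp_left, c.w, hg]
    · rw [Category.assoc, ← T.map_comp, ← Arrow.comp_left, c.w, hh]
    · rw [Category.assoc, ← T.map_comp, ← Arrow.comp_right, c.w, hk]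
  have e₁ : (E.d0.app w.left ≫ h) ≫ T.map (c.ι.app j).left =
      (η.app w.left ≫ T.map φ.left) ≫ T.map (c.ι.app j).left := by
    rw [Category.assoc, Category.assoc, hh, m.d0_h, ← T.map_comp, ← Arrow.comp_left, hφ]
  obtain ⟨j₁, u₁, h₁⟩ := IsCardinalPresentable.exists_eq_of_isColimit' κ hl _ _ e₁
  have e₂ : (E.d1.app w.left ≫ h) ≫ T.map (c.ι.app j).left =
      (w.hom ≫ g) ≫ T.map (c.ι.app j).left := by
    rw [Category.assoc, Category.assoc, hh, m.d1_h, hg]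
  obtain ⟨j₂, u₂, h₂⟩ := IsCardinalPresentable.exists_eq_of_isColimit' κ hl _ _ e₂
  have e₃ : (E.d0.app w.right ≫ k) ≫ T.map (c.ι.app j).right =
      (η.app w.right ≫ T.map φ.right) ≫ T.map (c.ι.app j).right := by
    rw [Category.assoc, Category.assoc, hk, m.d0_k, ← T.map_comp, ← Arrow.comp_right, hφ]
  obtain ⟨j₃, u₃, h₃⟩ := IsCardinalPresentable.exists_eq_of_isColimit' κ hr _ _ e₃
  have e₄ : (E.d1.app w.right ≫ k) ≫ T.map (c.ι.app j).right =
      (g ≫ T.map (D.obj j).hom) ≫ T.map (c.ι.app j).right := by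
    rw [Category.assoc, Category.assoc, hk, m.d1_k, ← hg, Category.assoc, ← T.map_comp,
      ← T.map_comp]
    exact g ≫= congrArg T.map (Arrow.w (c.ι.app j))
  obtain ⟨j₄, u₄, h₄⟩ := IsCardinalPresentable.exists_eq_of_isColimit' κ hr _ _ e₄
  replace h₁ : (E.d0.app w.left ≫ h) ≫ T.map (D.map u₁).left =
    (η.app w.left ≫ T.map φ.left) ≫ T.map (D.map u₁).left := h₁
  replace h₂ : (E.d1.app w.left ≫ h) ≫ T.map (D.map u₂).left =
    (w.hom ≫ g) ≫ T.map (D.map u₂).left := h₂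
  replace h₃ : (E.d0.app w.right ≫ k) ≫ T.map (D.map u₃).right =
    (η.app w.right ≫ T.map φ.right) ≫ T.map (D.map u₃).right := h₃
  replace h₄ : (E.d1.app w.right ≫ k) ≫ T.map (D.map u₄).right =
    (g ≫ T.map (D.obj j).hom) ≫ T.map (D.map u₄).right := h₄
  obtain ⟨l, u, v₁, v₂, v₃, v₄, e₁, e₂, e₃, e₄⟩ := exists_common_refinement u₁ u₂ u₃ u₄
  refine ⟨l, ⟨φ ≫ D.map u, g ≫ T.map (D.map u).left, h ≫ T.map (D.map u).left,
    k ≫ T.map (D.map u).right, ?_, ?_, ?_, ?_⟩, ?_⟩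
  · rw [← e₁, Arrow.comp_left]
    simpa only [D.map_comp, Arrow.comp_left, T.map_comp, Category.assoc] using
      h₁ =≫ T.map (D.map v₁).left
  · rw [← e₂]
    simpa only [D.map_comp, Arrow.comp_left, T.map_comp, Category.assoc] using
      h₂ =≫ T.map (D.map v₂).left
  · rw [← e₃, Arrow.comp_right]
    simpa only [D.map_comp, Arrow.comp_right, T.map_comp, Category.assoc] using
      h₃ =≫ T.map (D.map v₃).right
  · rw [Category.assoc, ← T.map_comp, Arrow.w, ← e₄]
    simpa only [D.map_comp, Arrow.comp_right, T.map_comp, Category.assoc] using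
      h₄ =≫ T.map (D.map v₄).right
  · ext1
    · change (φ ≫ D.map u) ≫ c.ι.app l = _
      rw [Category.assoc, c.w, hφ]
    · change (g ≫ T.map (D.map u).left) ≫ T.map (c.ι.app l).left = _
      rw [Category.assoc, ← T.map_comp, ← Arrow.comp_left, c.w, hg]
    · change (h ≫ T.map (D.map u).left) ≫ T.map (c.ι.app l).left = _
      rw [Category.assoc, ← T.map_comp, ← Arrow.comp_left, c.w, hh]
    · change (k ≫ T.map (D.map u).right) ≫ T.map (c.ι.app l).right = _
      rw [Category.assoc, ← T.map_comp, ← Arrow.comp_right, c.w, hk]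

end Presentable

lemma isWeakEq_iff {L An : MorphismProperty C} (hA : IsLeftAnodyneClass E L An)
    (hE : IsExactCylinder E L) (hη : ∀ X, An (η.app X)) (hT : ∀ X, IsFibrantObj An (T.obj X))
    (w : Arrow C) :
    IsWeakEq E An w.hom ↔ ∃ m : HomotopyInverse E η w w, m.φ = 𝟙 w := by
  have hη' (X : C) : IsWeakEq E An (η.app X) := hA.isWeakEq hE (hη X)
  have nat {X Y Z : C} (f : X ⟶ Y) (g : T.obj Y ⟶ Z) :
      f ≫ η.app Y ≫ g = η.app X ≫ T.map f ≫ g := (η_map_comp η f g).symm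
  rw [hA.isWeakEq_iff hE]
  constructor
  · intro hw
    obtain ⟨hU, -⟩ := hw _ (hT w.left)
    obtain ⟨-, hV⟩ := hw _ (hT w.right)
    obtain ⟨g, hg⟩ := hU (η.app w.left)
    have hg' := (hA.equivalence_homotopy hE _ (hT _)).symm hg
    obtain ⟨h, h₀, h₁⟩ := hg'
    have hk : E.Homotopy (η.app w.right) (g ≫ T.map w.hom) := by
      refine hV _ _ ?_
      have := Cylinder.Homotopy.postcomp (E := E) ⟨h, h₀, h₁⟩ (T.map w.hom)
      rw [Category.assoc] at this
      rwa [show w.hom ≫ η.app w.right = η.app w.left ≫ T.map w.hom from η.naturality w.hom]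
    obtain ⟨(k : E.I.obj w.right ⟶ _), k₀, k₁⟩ := hk
    refine ⟨⟨𝟙 w, g, h, k, h₀.trans ?_, h₁, k₀.trans ?_, k₁⟩, rfl⟩
    · rw [Arrow.id_left, T.map_id]; exact (Category.comp_id _).symm
    · rw [Arrow.id_right, T.map_id]; exact (Category.comp_id _).symm
  · rintro ⟨m, hm⟩ W hW
    have d0_h := m.d0_h
    have d0_k := m.d0_k
    rw [hm, Arrow.id_left, T.map_id] at d0_h
    rw [hm, Arrow.id_right, T.map_id] at d0_k
    have hgh : E.Homotopy (η.app w.left) (w.hom ≫ m.g) :=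
      ⟨m.h, d0_h.trans (Category.comp_id _), m.d1_h⟩
    have hgk : E.Homotopy (η.app w.right) (m.g ≫ T.map w.hom) :=
      ⟨m.k, d0_k.trans (Category.comp_id _), m.d1_k⟩
    have eW (X : C) := hA.equivalence_homotopy hE X hW
    constructor
    · intro a
      obtain ⟨a', rfl⟩ := hW _ (hη w.left) a
      refine ⟨m.g ≫ a', (eW _).symm ?_⟩
      have := hgh.postcomp a'
      rwa [Category.assoc] at this
    · intro b b' hb
      obtain ⟨β, rfl⟩ := hW _ (hη w.right) b
      obtain ⟨β', rfl⟩ := hW _ (hη w.right) b'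
      have h₁ : E.Homotopy (T.map w.hom ≫ β) (T.map w.hom ≫ β') := by
        refine ((hA.isWeakEq_iff hE _).1 (hη' w.left) W hW).2 _ _ ?_
        have e := nat w.hom β
        have e' := nat w.hom β'
        exact e ▸ e' ▸ hb
      have h₂ := hgk.postcomp β
      have h₃ := hgk.postcomp β'
      rw [Category.assoc] at h₂ h₃
      exact (eW _).trans h₂ ((eW _).trans (h₁.precomp m.g) ((eW _).symm h₃))

end HomotopyInverse

namespace HomotopyInverse

variable [HasColimits C] {E : Cylinder C} {T : C ⥤ C} {η : 𝟭 C ⟶ T}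

/-- A compatible sequence of homotopy inverses gives a homotopy inverse on the colimit. -/
lemma exists_of_sequence [PreservesColimits E.I] {X : ℕ → Arrow C}
    (m : ∀ n, HomotopyInverse E η (X n) (X (n + 1)))
    (hm : ∀ n, (m (n + 1)).pre (m n).φ = (m n).post (m (n + 1)).φ)
    {c : Cocone (Functor.ofSequence fun n => (m n).φ)} (hc : IsColimit c) :
    ∃ m₀ : HomotopyInverse E η c.pt c.pt, m₀.φ = 𝟙 c.pt := by
  have hι (n : ℕ) : (m n).φ ≫ c.ι.app (n + 1) = c.ι.app n := by
    exact (congrArg (· ≫ _) (Functor.ofSequence_map_homOfLE_succ _ n).symm).trans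
      (c.w (homOfLE (Nat.le_add_right n 1)))
  let m' (n : ℕ) : HomotopyInverse E η (X n) c.pt := (m n).post (c.ι.app (n + 1))
  have hsucc (n : ℕ) : (m' (n + 1)).pre (m n).φ = m' n := by
    refine (pre_post _ _ _).symm.trans ?_
    rw [hm]
    exact (post_post _ _ _).trans (congrArg (m n).post (hι (n + 1)))
  have hm' : ∀ (k i j : ℕ) (_ : i + k = j) (u : i ⟶ j),
      (m' j).pre ((Functor.ofSequence fun n => (m n).φ).map u) = m' i := by
    intro k
    induction k with
    | zero =>
      rintro i _ rfl u
      obtain rfl := Subsingleton.elim u (𝟙 i)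
      rw [CategoryTheory.Functor.map_id]
      exact pre_id _
    | succ k ih =>
      rintro i _ rfl u
      obtain rfl := Subsingleton.elim u
        (homOfLE (Nat.le_add_right i k) ≫ homOfLE (Nat.le_add_right (i + k) 1))
      rw [Functor.map_comp, Functor.ofSequence_map_homOfLE_succ]
      refine (pre_pre _ _ _).symm.trans ?_
      refine (congrArg _ (hsucc (i + k))).trans (ih i _ rfl _)
  have : PreservesColimitsOfSize.{0, 0} E.I := preservesColimitsOfSize_shrink E.I
  obtain ⟨m₀, hm₀⟩ := exists_of_isColimit hc m'
    (fun {i j} u => hm' (j - i) i j (Nat.add_sub_cancel' (leOfHom u)) u)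
  refine ⟨m₀, hc.hom_ext fun n => ?_⟩
  rw [Category.comp_id]
  exact (congrArg HomotopyInverse.φ (hm₀ n)).trans (hι n)

section Filtered

variable (κ : Cardinal.{v}) [Fact κ.IsRegular] [T.IsCardinalAccessible κ]
  {J : Type v} [SmallCategory J] [CategoryTheory.IsCardinalFiltered J κ] {D : J ⥤ Arrow C}
  [∀ j, IsCardinalPresentable (D.obj j) κ]
  [∀ j, IsCardinalPresentable (D.obj j).left κ] [∀ j, IsCardinalPresentable (D.obj j).right κ]
  [∀ j, IsCardinalPresentable (E.I.obj (D.obj j).left) κ]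
  [∀ j, IsCardinalPresentable (E.I.obj (D.obj j).right) κ]
  {c : Cocone D} (hc : IsColimit c)

include κ hc

lemma exists_next (m : HomotopyInverse E η c.pt c.pt) (hm : m.φ = 𝟙 c.pt) {i j : J}
    (m₀ : HomotopyInverse E η (D.obj i) (D.obj j))
    (h₀ : m₀.post (c.ι.app j) = m.pre (c.ι.app i)) :
    ∃ (k : J) (m₁ : HomotopyInverse E η (D.obj j) (D.obj k)),
      m₁.post (c.ι.app k) = m.pre (c.ι.app j) ∧ m₁.pre m₀.φ = m₀.post m₁.φ := by
  obtain ⟨k', m', hm'⟩ := exists_post_eq κ hc (m.pre (c.ι.app j))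
  have e₀ : m₀.φ ≫ c.ι.app j = c.ι.app i := by
    have := congrArg HomotopyInverse.φ h₀
    simp only [post_φ, pre_φ, hm] at this
    exact this.trans (Category.comp_id _)
  have e₁ : m'.φ ≫ c.ι.app k' = c.ι.app j := by
    have := congrArg HomotopyInverse.φ hm'
    simp only [post_φ, pre_φ, hm] at this
    exact this.trans (Category.comp_id _)
  obtain ⟨k, u, hu⟩ := exists_post_map_eq κ hc (m'.pre m₀.φ) (m₀.post m'.φ) (by
    rw [pre_post, hm', post_post, e₁, h₀]
    exact (pre_pre _ _ _).trans (by rw [e₀]))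
  refine ⟨k, m'.post (D.map u), ?_, ?_⟩
  · rw [post_post, c.w, hm']
  · rw [← pre_post, hu, post_post, post_φ]

lemma exists_sequence (m : HomotopyInverse E η c.pt c.pt) (hm : m.φ = 𝟙 c.pt) {s : Arrow C}
    [IsCardinalPresentable s κ] (f : s ⟶ c.pt) :
    ∃ (i : ℕ → J) (m' : ∀ n, HomotopyInverse E η (D.obj (i n)) (D.obj (i (n + 1))))
      (a : s ⟶ D.obj (i 0)), a ≫ c.ι.app (i 0) = f ∧
      (∀ n, (m' (n + 1)).pre (m' n).φ = (m' n).post (m' (n + 1)).φ) ∧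
      ∀ n, (m' n).φ ≫ c.ι.app (i (n + 1)) = c.ι.app (i n) := by
  obtain ⟨i₀, a, ha⟩ := IsCardinalPresentable.exists_hom_of_isColimit κ hc f
  obtain ⟨j₀, m₀, hm₀⟩ := exists_post_eq κ hc (m.pre (c.ι.app i₀))
  let Node : Type v := Σ i j : J,
    { m₀ : HomotopyInverse E η (D.obj i) (D.obj j) // m₀.post (c.ι.app j) = m.pre (c.ι.app i) }
  choose k m₁ hm₁ hc₁ using fun x : Node => exists_next κ hc m hm x.2.2.1 x.2.2.2
  let x : ℕ → Node := Nat.rec ⟨i₀, j₀, m₀, hm₀⟩ fun _ y => ⟨y.2.1, k y, m₁ y, hm₁ y⟩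
  refine ⟨fun n => (x n).1, fun n => (x n).2.2.1, a, ha, fun n => hc₁ (x n), fun n => ?_⟩
  have := congrArg HomotopyInverse.φ (x n).2.2.2
  simp only [post_φ, pre_φ, hm] at this
  exact this.trans (Category.comp_id _)

end Filtered

end HomotopyInverse

section SolutionSet

variable [HasColimits C] {L An : MorphismProperty C} {E : Cylinder C}

/-- If the fibrant replacement is `κ`-accessible, the weak equivalences satisfy the solution set
condition at `κ`-presentable arrows. -/
lemma exists_solution_set_of_accessible (hA : IsLeftAnodyneClass E L An)
    (hE : IsExactCylinder E L) {T : C ⥤ C} {η : 𝟭 C ⟶ T} (hη : ∀ X, An (η.app X))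
    (hT : ∀ X, IsFibrantObj An (T.obj X)) (κ : Cardinal.{v}) [Fact κ.IsRegular]
    [T.IsCardinalAccessible κ] [HasCardinalFilteredGenerator (Arrow C) κ]
    (hl : ∀ w : Arrow C, IsCardinalPresentable w κ → IsCardinalPresentable w.left κ)
    (hr : ∀ w : Arrow C, IsCardinalPresentable w κ → IsCardinalPresentable w.right κ)
    (hI : ∀ X : C, IsCardinalPresentable X κ → IsCardinalPresentable (E.I.obj X) κ) :
    ∃ W₀ : Set (Arrow C), Small.{v} W₀ ∧ (∀ w ∈ W₀, IsWeakEq E An w.hom) ∧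
      ∀ (s : Arrow C) (_ : IsCardinalPresentable s κ) (w : Arrow C) (_ : IsWeakEq E An w.hom)
        (f : s ⟶ w), ∃ w₀ ∈ W₀, ∃ (a : s ⟶ w₀) (b : w₀ ⟶ w), a ≫ b = f := by
  have := hE.preservesColimits
  obtain ⟨Q, _, hQ⟩ := HasCardinalFilteredGenerator.exists_small_generator (Arrow C) κ
  have : Small.{v} (Subtype Q) := inferInstanceAs (ObjectProperty.Small.{v} Q)
  let Idx := Σ X : ℕ → Subtype Q, ∀ n, (X n).1 ⟶ (X (n + 1)).1
  let W (x : Idx) : Arrow C := colimit (Functor.ofSequence x.2)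
  refine ⟨Set.range W ∩ {w | IsWeakEq E An w.hom}, small_subset Set.inter_subset_left,
    fun w hw => hw.2, fun s _ w hw f => ?_⟩
  obtain ⟨m, hm⟩ := (HomotopyInverse.isWeakEq_iff hA hE hη hT w).1 hw
  obtain ⟨J, _, _, ⟨p⟩⟩ := hQ.exists_colimitsOfShape w
  have h₀ (j : J) : IsCardinalPresentable (p.diag.obj j) κ :=
    hQ.le_isCardinalPresentable _ (p.prop_diag_obj j)
  have h₁ (j : J) := hl _ (h₀ j)
  have h₂ (j : J) := hr _ (h₀ j)
  have h₃ (j : J) := hI _ (h₁ j)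
  have h₄ (j : J) := hI _ (h₂ j)
  obtain ⟨i, m', a, ha, hm', hι⟩ :=
    HomotopyInverse.exists_sequence κ p.isColimit m hm f
  let x : Idx := ⟨fun n => ⟨p.diag.obj (i n), p.prop_diag_obj _⟩, fun n => (m' n).φ⟩
  let F : ℕ ⥤ Arrow C := Functor.ofSequence fun n => (m' n).φ
  let b : W x ⟶ w := colimit.desc F ⟨w, NatTrans.ofSequence (fun n => p.ι.app (i n)) fun n =>
    ((Functor.ofSequence_map_homOfLE_succ _ n) =≫ _).trans
      ((hι n).trans (Category.comp_id _).symm)⟩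
  refine ⟨W x, ⟨⟨x, rfl⟩, ?_⟩, a ≫ colimit.ι F 0, b, ?_⟩
  · exact (HomotopyInverse.isWeakEq_iff hA hE hη hT (W x)).2
      (HomotopyInverse.exists_of_sequence m' hm' (colimit.isColimit F))
  · have hb : colimit.ι F 0 ≫ b = p.ι.app (i 0) := colimit.ι_desc _ _
    exact (Category.assoc _ _ _).trans ((a ≫= hb).trans ha)

instance (priority := low) [IsLocallyPresentable.{v} C] : HasTerminal C := by
  obtain ⟨κ, _, _⟩ := IsLocallyPresentable.exists_cardinal.{v} C
  obtain ⟨Q, _, hQ⟩ := HasCardinalFilteredGenerator.exists_small_generator C κ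
  have : Small.{v} (Subtype Q) := inferInstanceAs (ObjectProperty.Small.{v} Q)
  have : Small.{v} Q.FullSubcategory :=
    small_of_injective (β := Subtype Q) (f := fun X => ⟨X.1, X.2⟩) fun X Y h => by
      cases X; cases Y; cases h; rfl
  have := essentiallySmall_of_small_of_locallySmall.{v} Q.FullSubcategory
  have := hasColimitsOfShape_of_essentiallySmall.{v} Q.FullSubcategory C
  have hY (X : C) : Nonempty (X ⟶ colimit Q.ι) := by
    obtain ⟨J, _, _, ⟨p⟩⟩ := hQ.exists_colimitsOfShape X
    let D : J ⥤ Q.FullSubcategory := Q.lift p.diag p.prop_diag_obj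
    exact ⟨p.isColimit.desc ((colimit.cocone Q.ι).whisker D)⟩
  have : HasInitial Cᵒᵖ := hasInitial_of_weakly_initial_and_hasWideEqualizers
    (T := Opposite.op (colimit Q.ι)) fun X => ⟨(hY X.unop).some.op⟩
  exact hasTerminal_of_hasInitial_op

lemma isFibrantObj_of_generators [HasTerminal C] (W : C) (Λ : Set (Arrow C))
    (hΛ : An = llp (rlp (ofArrows Λ)))
    (h : ∀ w ∈ Λ, ∀ a : w.left ⟶ W, ∃ b : w.right ⟶ W, w.hom ≫ b = a) : IsFibrantObj An W := by
  intro A B f hf a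
  rw [hΛ] at hf
  have := hf (terminal.from W) fun A B g hg => ⟨fun {u v} sq => by
    obtain ⟨b, hb⟩ := h _ hg u
    exact ⟨⟨b, hb, terminal.hom_ext _ _⟩⟩⟩
  have sq : CommSq a f (terminal.from W) (terminal.from B) := ⟨terminal.hom_ext _ _⟩
  exact ⟨sq.lift, sq.fac_left⟩

end SolutionSet

section Generators

lemma ofArrows_eq_ofHoms (S : Set (Arrow C)) [Small.{v} S] :
    ofArrows S = .ofHoms fun i : Shrink.{v} S => ((equivShrink S).symm i).1.hom := by
  ext A B f
  rw [MorphismProperty.ofHoms_iff]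
  constructor
  · intro hf
    exact ⟨equivShrink S ⟨_, hf⟩, by rw [Equiv.symm_apply_apply]; rfl⟩
  · rintro ⟨i, hi⟩
    have := ((equivShrink S).symm i).2
    rwa [show ((equivShrink S).symm i).1 = Arrow.mk f from hi.symm] at this

/-- The small object argument in a locally presentable category. -/
lemma exists_factorization [LocallyPresentable C] (S : Set (Arrow C)) [Small.{v} S] {X Y : C}
    (f : X ⟶ Y) : ∃ (Z : C) (i : X ⟶ Z) (p : Z ⟶ Y),
      llp (rlp (ofArrows S)) i ∧ rlp (ofArrows S) p ∧ i ≫ p = f := by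
  rw [ofArrows_eq_ofHoms]
  set f' := fun i : Shrink.{v} S => ((equivShrink S).symm i).1.hom
  obtain ⟨κ, _, -, hκ⟩ := exists_regular_cardinal_presentable
    (fun i : Shrink.{v} S => ((equivShrink S).symm i).1.left) 0
  have : Nonempty κ.ord.ToType := by
    simpa using Cardinal.IsRegular.ne_zero (Fact.out : κ.IsRegular)
  let _ := WellFoundedLT.toOrderBot κ.ord.ToType
  have : (MorphismProperty.ofHoms f').IsCardinalForSmallObjectArgument κ :=
    { preservesColimit := by
        rintro _ _ X Y _ ⟨i⟩ f hf
        have := hκ i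
        have := preservesColimitsOfShape_of_isCardinalPresentable
          ((equivShrink S).symm i).1.left κ κ.ord.ToType
        infer_instance }
  have : (MorphismProperty.ofHoms f').HasSmallObjectArgument :=
    ⟨κ, inferInstance, inferInstance, this⟩
  let d := MorphismProperty.factorizationData (MorphismProperty.ofHoms f').rlp.llp
    (MorphismProperty.ofHoms f').rlp f
  exact ⟨d.Z, d.i, d.p, d.hi, d.hp, d.fac⟩

variable [LocallyPresentable C] {L R An : MorphismProperty C} {E : Cylinder C}

lemma IsLeftAnodyneClass.exists_anodyne_fibration (hA : IsLeftAnodyneClass E L An) {X Y : C}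
    (f : X ⟶ Y) : ∃ (Z : C) (i : X ⟶ Z) (p : Z ⟶ Y), An i ∧ IsFib An p ∧ i ≫ p = f := by
  obtain ⟨Λ, _, -, rfl⟩ := hA.exists_generating_set
  obtain ⟨Z, i, p, hi, hp, h⟩ := exists_factorization Λ f
  exact ⟨Z, i, p, hi, fun _ _ f hf => hf p hp, h⟩

lemma IsLeftAnodyneClass.exists_accessible_replacement (hA : IsLeftAnodyneClass E L An) :
    ∃ (κ : Cardinal.{v}) (_ : Fact κ.IsRegular) (T : C ⥤ C) (η : 𝟭 C ⟶ T),
      T.IsCardinalAccessible κ ∧ (∀ X, An (η.app X)) ∧ ∀ X, IsFibrantObj An (T.obj X) := by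
  obtain ⟨Λ, _, -, hΛ⟩ := hA.exists_generating_set
  obtain ⟨κ, _, -, hκ⟩ := exists_regular_cardinal_presentable
    (fun i : Shrink.{v} Λ => ((equivShrink Λ).symm i).1.left) 0
  obtain ⟨T, η, hT, hη, h⟩ := Paper.exists_accessible_replacement (κ := κ)
    fun i : Shrink.{v} Λ => ((equivShrink Λ).symm i).1.hom
  refine ⟨κ, inferInstance, T, η, hT, fun X => ?_, fun X => ?_⟩
  · rw [hΛ, ofArrows_eq_ofHoms]
    exact hη X
  · refine isFibrantObj_of_generators _ Λ hΛ fun w hw => ?_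
    have := h X (equivShrink Λ ⟨w, hw⟩)
    rwa [Equiv.symm_apply_apply] at this

lemma IsLeftAnodyneClass.exists_fibrant_replacement (hA : IsLeftAnodyneClass E L An) (X : C) :
    ∃ (X' : C) (j : X ⟶ X'), An j ∧ IsFibrantObj An X' := by
  obtain ⟨κ, _, T, η, -, hη, hT⟩ := hA.exists_accessible_replacement
  exact ⟨T.obj X, η.app X, hη X, hT X⟩

/-- The weak equivalences satisfy the solution set condition at every small set of arrows. -/
lemma IsLeftAnodyneClass.exists_solution_set (hA : IsLeftAnodyneClass E L An)
    (hE : IsExactCylinder E L) (S : Set (Arrow C)) [Small.{v} S] :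
    ∃ W₀ : Set (Arrow C), Small.{v} W₀ ∧ (∀ w ∈ W₀, IsWeakEq E An w.hom) ∧
      ∀ s ∈ S, ∀ (w : Arrow C) (_ : IsWeakEq E An w.hom) (f : s ⟶ w),
        ∃ w₀ ∈ W₀, ∃ (a : s ⟶ w₀) (b : w₀ ⟶ w), a ≫ b = f := by
  have := hE.preservesColimits
  have : PreservesColimits (Arrow.leftFunc : Arrow C ⥤ C) := ⟨inferInstance⟩
  have : PreservesColimits (Arrow.rightFunc : Arrow C ⥤ C) := ⟨inferInstance⟩
  obtain ⟨κ₁, _, T, η, _, hη, hT⟩ := hA.exists_accessible_replacement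
  obtain ⟨κ₂, hl⟩ := exists_cardinal_preserves (Arrow.leftFunc : Arrow C ⥤ C)
  obtain ⟨κ₃, hr⟩ := exists_cardinal_preserves (Arrow.rightFunc : Arrow C ⥤ C)
  obtain ⟨κ₄, hI⟩ := exists_cardinal_preserves E.I
  obtain ⟨κ₅, _, _⟩ := IsLocallyPresentable.exists_cardinal.{v} (Arrow C)
  obtain ⟨κ, _, hκ, hS⟩ := exists_regular_cardinal_presentable
    (fun i : Shrink.{v} S => ((equivShrink S).symm i).1) (κ₁ ⊔ κ₂ ⊔ κ₃ ⊔ κ₄ ⊔ κ₅)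
  simp only [sup_le_iff, and_assoc] at hκ
  obtain ⟨h₁, h₂, h₃, h₄, h₅⟩ := hκ
  have := Functor.isCardinalAccessible_of_le T h₁
  have := IsCardinalLocallyPresentable.of_le (Arrow C) h₅
  obtain ⟨W₀, hW₀, hw, h⟩ := exists_solution_set_of_accessible hA hE hη hT κ (hl κ h₂) (hr κ h₃)
    (hI κ h₄)
  refine ⟨W₀, hW₀, hw, fun s hs => h s ?_⟩
  have := hS (equivShrink S ⟨s, hs⟩)
  rwa [Equiv.symm_apply_apply] at this

end Generators

section Model

variable [LocallyPresentable C] {L R An : MorphismProperty C} {E : Cylinder C}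

/-- A small set of trivial cofibrations detecting trivial fibrations among weak equivalences. -/
lemma IsLeftAnodyneClass.exists_small_trivialCofibrations (hA : IsLeftAnodyneClass E L An)
    (hE : IsExactCylinder E L) (hW : IsCofGenWFS L R) :
    ∃ J : Set (Arrow C), Small.{v} J ∧ ofArrows J ≤ trivialCofibrations E L An ∧
      ∀ ⦃X Y : C⦄ (p : X ⟶ Y), rlp (ofArrows J) p → IsWeakEq E An p → R p := by
  obtain ⟨S, _, hS⟩ := hW.exists_generating_set
  obtain ⟨W₀, _, hW₀, hsol⟩ := hA.exists_solution_set hE S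
  have hSL (s : Arrow C) (hs : s ∈ S) : L s.hom := by
    rw [hS, llp_eq, rlp_eq]
    exact MorphismProperty.le_llp_rlp _ _ hs
  let Idx := Σ (s : S) (w : W₀), s.1 ⟶ w.1
  have hfac (x : Idx) := hW.factorization
    (pushout.desc x.2.2.right x.2.1.1.hom x.2.2.w.symm :
      pushout x.1.1.hom x.2.2.left ⟶ x.2.1.1.right)
  choose Z l r hl hr hlr using hfac
  let j (x : Idx) : x.2.1.1.left ⟶ Z x := pushout.inr x.1.1.hom x.2.2.left ≫ l x
  have hjr (x : Idx) : j x ≫ r x = x.2.1.1.hom := by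
    simp only [j, Category.assoc, hlr, pushout.inr_desc]
  refine ⟨Set.range fun x : Idx => Arrow.mk (j x), inferInstance, ?_, ?_⟩
  · rintro A B f ⟨x, hx⟩
    have hj : trivialCofibrations E L An (j x) := by
      refine ⟨hW.left_comp ?_ (hl x), IsWeakEq.cancel_right (isWeakEq_of_right hW hA hE (hr x)) ?_⟩
      · have := hSL _ x.1.2
        rw [hW.eq_llp, llp_eq] at this ⊢
        exact MorphismProperty.pushout_inr _ _ this
      · rw [hjr]
        exact hW₀ _ x.2.1.2
    cases hx
    exact hj
  · intro X Y p hp hpw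
    have hR : R = rlp (ofArrows S) := by
      rw [hW.rlp_eq, hS]
      simp only [llp_eq, rlp_eq]
      exact MorphismProperty.rlp_llp_rlp _
    rw [hR]
    refine fun A B s hs => ⟨fun {u v} sq => ?_⟩
    obtain ⟨w, hw, a, b, hab⟩ := hsol _ hs (Arrow.mk p) hpw (Arrow.homMk u v sq.w)
    let x : Idx := ⟨⟨_, hs⟩, ⟨w, hw⟩, a⟩
    have := hp (j x) ⟨x, rfl⟩
    have sq' : CommSq b.left (j x) p (r x ≫ b.right) :=
      ⟨b.w.trans ((hjr x).symm =≫ b.right |>.trans (Category.assoc _ _ _))⟩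
    have hu : a.left ≫ b.left = u := congrArg CommaMorphism.left hab
    have hv : a.right ≫ b.right = v := congrArg CommaMorphism.right hab
    let t : B ⟶ Z x := pushout.inl s a.left ≫ l x
    have ht₁ : s ≫ t = a.left ≫ j x := by
      simp only [t, j, ← Category.assoc]
      exact pushout.condition =≫ l x
    have ht₂ : t ≫ r x = a.right := by
      simp only [t, Category.assoc, hlr]
      exact pushout.inl_desc _ _ _
    refine ⟨⟨t ≫ sq'.lift, ?_, ?_⟩⟩
    · rw [← Category.assoc, ht₁, Category.assoc, sq'.fac_left]
      exact hu
    · rw [Category.assoc, sq'.fac_right, ← Category.assoc, ht₂]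
      exact hv

/-- The model structure with cofibrations `L` associated to a class of left anodyne extensions. -/
def modelStructure (hA : IsLeftAnodyneClass E L An) (hE : IsExactCylinder E L)
    (hW : IsCofGenWFS L R)
    (hR : ∀ ⦃X Y : C⦄ (p : X ⟶ Y), rlp (trivialCofibrations E L An) p → IsWeakEq E An p → R p)
    (hfac : ∀ ⦃X Y : C⦄ (f : X ⟶ Y), ∃ (Z : C) (i : X ⟶ Z) (p : Z ⟶ Y),
      trivialCofibrations E L An i ∧ rlp (trivialCofibrations E L An) p ∧ i ≫ p = f) :
    ModelStructure C where
  weq _ _ f := IsWeakEq E An f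
  cof := L
  fib := rlp (trivialCofibrations E L An)
  weq_id := IsWeakEq.id
  weq_comp _ _ _ _ _ := IsWeakEq.comp
  weq_cancel_left _ _ _ _ _ := IsWeakEq.cancel_left
  weq_cancel_right _ _ _ _ _ := IsWeakEq.cancel_right
  weq_retract _ _ _ _ _ _ := IsWeakEq.retract
  cof_retract _ _ _ _ _ _ h := by
    rw [hW.eq_llp]
    exact h.llp
  fib_retract _ _ _ _ _ _ h := h.rlp
  lift_trivCof_fib _ _ _ _ i p hi hi' hp := hp i ⟨hi, hi'⟩
  lift_cof_trivFib _ _ _ _ i p hi hp hp' := by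
    have := hR p hp hp'
    rw [hW.rlp_eq] at this
    exact this i hi
  fact_cof_trivFib X Y f := by
    obtain ⟨Z, i, p, hi, hp, h⟩ := hW.factorization f
    refine ⟨Z, i, p, hi, fun _ _ j hj => ?_, isWeakEq_of_right hW hA hE hp, h⟩
    rw [hW.rlp_eq] at hp
    exact hp j hj.1
  fact_trivCof_fib X Y f := by
    obtain ⟨Z, i, p, hi, hp, h⟩ := hfac f
    exact ⟨Z, i, p, hi.1, hi.2, hp, h⟩

lemma IsLeftAnodyneClass.exists_trivialCofibrations_factorization
    (hA : IsLeftAnodyneClass E L An) (hE : IsExactCylinder E L) (hW : IsCofGenWFS L R) {X Y : C}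
    (f : X ⟶ Y) : ∃ (Z : C) (i : X ⟶ Z) (p : Z ⟶ Y),
      trivialCofibrations E L An i ∧ rlp (trivialCofibrations E L An) p ∧ i ≫ p = f := by
  obtain ⟨J, _, hJ, hR⟩ := hA.exists_small_trivialCofibrations hE hW
  have hJ' := llp_rlp_le_trivialCofibrations hA hE hW (fun _ _ => hA.exists_anodyne_fibration)
    hA.exists_fibrant_replacement hJ
  obtain ⟨Z, i, p, hi, hp, h⟩ := exists_factorization J f
  refine ⟨Z, i, p, hJ' i hi, fun A B c hc => ?_, h⟩
  obtain ⟨D, j, q, hj, hq, hjq⟩ := exists_factorization J c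
  have hqR : R q := hR q hq ((hJ' j hj).2.cancel_left (hjq ▸ hc.2))
  rw [hW.rlp_eq] at hqR
  exact (isRetractOf_left hjq (hqR c hc.1)).llp hj p hp

lemma ModelStructure.fib_eq (M : ModelStructure C) :
    M.fib = rlp fun _ _ i => M.cof i ∧ M.weq i := by
  ext X Y p
  refine ⟨fun hp _ _ i hi => M.lift_trivCof_fib i p hi.1 hi.2 hp, fun hp => ?_⟩
  obtain ⟨Z, i, q, hi, hi', hq, h⟩ := M.fact_trivCof_fib p
  exact M.fib_retract p q (isRetractOf_right h (hp i ⟨hi, hi'⟩)) hq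

lemma ModelStructure.ext_of_cof_of_weq {M M' : ModelStructure C} (hc : M.cof = M'.cof)
    (hw : M.weq = M'.weq) : M = M' := by
  have hf : M.fib = M'.fib := by rw [M.fib_eq, M'.fib_eq, hc, hw]
  cases M; cases M'
  cases hc; cases hw; cases hf
  rfl

end Model

/-- Theorem 2.15 (lefthm): the Covariant model structure associated to a left
homotopical structure. -/
theorem statement_1    {C : Type u} [Category.{v} C] [LocallyPresentable C]
    (L R : MorphismProperty C) (hW : IsCofGenWFS L R)
    (E : Cylinder C) (hE : IsExactCylinder E L)
    (Anl : MorphismProperty C) (hAnl : IsLeftAnodyneClass E L Anl) :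
    ∃ M : ModelStructure C,
      M.cof = L ∧
      (∀ ⦃A B : C⦄ (f : A ⟶ B), M.weq f ↔ IsWeakEq E Anl f) ∧
      (∀ W : C, M.Fibrant W ↔ IsFibrantObj Anl W) ∧
      (∀ ⦃X Y : C⦄ (p : X ⟶ Y), IsFibrantObj Anl X → IsFibrantObj Anl Y →
        (M.fib p ↔ IsFib Anl p)) ∧
      (∀ M' : ModelStructure C, M'.cof = L →
        (∀ ⦃A B : C⦄ (f : A ⟶ B), M'.weq f ↔ IsWeakEq E Anl f) → M' = M) := by
  have hTC : Anl ≤ trivialCofibrations E L Anl := fun _ _ i hi =>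
    ⟨hAnl.le i hi, hAnl.isWeakEq hE hi⟩
  refine ⟨modelStructure hAnl hE hW ?_
    fun _ _ => hAnl.exists_trivialCofibrations_factorization hE hW, rfl, fun _ _ _ => Iff.rfl,
    fun W => ⟨fun h A B i hi => h i (hTC i hi).1 (hTC i hi).2, fun h A B i hi hi' a =>
      exists_extension_of_trivialCofibrations hAnl hE h ⟨hi, hi'⟩ a⟩,
    fun X Y p _ hY => ⟨fun h A B i hi => h i (hTC i hi), fun h A B i hi => ?_⟩,
    fun M' hc hw => ?_⟩
  · obtain ⟨J, _, hJ, hR⟩ := hAnl.exists_small_trivialCofibrations hE hW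
    exact fun X Y p hp => hR p fun _ _ i hi => hp i (hJ i hi)
  · exact ((trivialCofibrations_iff hAnl hE hW (fun _ _ => hAnl.exists_anodyne_fibration)
      hAnl.exists_fibrant_replacement i).1 hi).2 p ⟨h, hY⟩
  · refine ModelStructure.ext_of_cof_of_weq hc ?_
    ext A B f
    exact hw f

end Paper
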